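/- arXiv:math/9802045 — 3 statements merged into one kernel-verified Lean document; each statement's English description precedes it below -/
import Mathlib

section
/- Let t0, x0 ∈ ℝ and let F1, F2 be functions on ℝ that are bounded by M and Lipschitz with constant at most M. Let B_t be a continuous process such that: (i) there exist c1 > 0 and γ ∈ (0,1) with P(B_t ∈ dy | F_s) ≤ c1 (t − s)^{−γ} dy for all y ∈ ℝ whenever s < t; and (ii) if A_t is an adapted process with A_{t0} = x0 whose paths are Lipschitz with constant M, then for each x and every s > 0 the law of {B_t + A_t, t0 ≤ t ≤ t0 + s} under P^x is mutually absolutely continuous with respect to the law of {B_t, t0 ≤ t ≤ t0 + s} under P^{x + x0}. Then with probability one there exists a unique Lipschitz solution of dX_t/dt = F1(X_t) when X_t > B_t, dX_t/dt = F2(X_t) when X_t < B_t, X(t0) = x0, for all t ≥ t0. -/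
open MeasureTheory ProbabilityTheory Filter Set

/-- `x` is a Lipschitz solution on `S` of the ODE `dx/dt = F1 x` when `x > b`,
`dx/dt = F2 x` when `x < b`, with `x t0 = x0`. -/
def IsLipSolutionOn (F1 F2 : ℝ → ℝ) (b : ℝ → ℝ) (t0 x0 : ℝ) (S : Set ℝ) (x : ℝ → ℝ) :
    Prop :=
  x t0 = x0 ∧ (∃ K : NNReal, LipschitzOnWith K x S) ∧
  (∀ t ∈ S, b t < x t → HasDerivWithinAt x (F1 (x t)) S t) ∧
  (∀ t ∈ S, x t < b t → HasDerivWithinAt x (F2 (x t)) S t)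

lemma IsLipSolutionOn.hasDerivAt_of_lt {F1 F2 b X : ℝ → ℝ} {t0 x0 s : ℝ}
    (hX : IsLipSolutionOn F1 F2 b t0 x0 (Ici t0) X) (hs : t0 < s) (h : b s < X s) :
    HasDerivAt X (F1 (X s)) s :=
  (hX.2.2.1 s hs.le h).hasDerivAt (Ici_mem_nhds hs)

lemma IsLipSolutionOn.hasDerivAt_of_gt {F1 F2 b X : ℝ → ℝ} {t0 x0 s : ℝ}
    (hX : IsLipSolutionOn F1 F2 b t0 x0 (Ici t0) X) (hs : t0 < s) (h : X s < b s) :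
    HasDerivAt X (F2 (X s)) s :=
  (hX.2.2.2 s hs.le h).hasDerivAt (Ici_mem_nhds hs)

/-- The growth of the distance between two solutions away from the barrier is controlled by the
Lipschitz constant of the drifts, so it is otherwise bounded by the occupation time of the barrier
near one of the two solutions. -/
lemma IsLipSolutionOn.abs_sub_le_add_occupation {F1 F2 b X Y : ℝ → ℝ} {t0 x0 : ℝ} {L KX KY : NNReal}
    (hF1 : LipschitzWith L F1) (hF2 : LipschitzWith L F2) (hb : Continuous b)
    (hX : IsLipSolutionOn F1 F2 b t0 x0 (Ici t0) X)
    (hY : IsLipSolutionOn F1 F2 b t0 x0 (Ici t0) Y)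
    (hKX : LipschitzOnWith KX X (Ici t0)) (hKY : LipschitzOnWith KY Y (Ici t0))
    {r t ε : ℝ} (hr : t0 ≤ r) (hrt : r ≤ t) (h0 : X r = Y r)
    (hD : ∀ s ∈ Ico r t, |X s - Y s| ≤ ε) :
    |X t - Y t| ≤ L * ε * (t - r) +
      (KX + KY) * volume.real {s | s ∈ Ico r t ∧ |b s - X s| ≤ ε} := by
  set Δ : ℝ → ℝ := fun s => X s - Y s with hΔ
  have hΔL : LipschitzOnWith (KX + KY) Δ (Ici t0) := hKX.sub hKY
  have hsub : uIcc r t ⊆ Ici t0 := by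
    rw [uIcc_of_le hrt]; exact fun s hs => hr.trans hs.1
  have hint := (hΔL.mono hsub).absolutelyContinuousOnInterval.integral_deriv_eq_sub
  have hXc : Continuous fun s => X (max t0 s) :=
    hKX.continuousOn.comp_continuous (by fun_prop) fun s => mem_Ici.2 (le_max_left _ _)
  set S : Set ℝ := {s | |b s - X (max t0 s)| ≤ ε} with hS
  have hSm : MeasurableSet S := (isClosed_le (hb.sub hXc).abs continuous_const).measurableSet
  have hΔt : |X t - Y t| = ‖∫ s in r..t, deriv Δ s‖ := by
    rw [hint, Real.norm_eq_abs]; simp [hΔ, h0]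
  have hI : Integrable (S.indicator fun _ => ((KX : ℝ) + KY)) (volume.restrict (Ioo r t)) :=
    (integrable_const _).indicator hSm
  rw [hΔt, intervalIntegral.integral_of_le hrt, integral_Ioc_eq_integral_Ioo]
  calc ‖∫ s in Ioo r t, deriv Δ s‖
      ≤ ∫ s in Ioo r t, (L * ε + S.indicator (fun _ => ((KX : ℝ) + KY)) s) := by
        refine norm_integral_le_of_norm_le ((integrable_const _).add hI) ?_
        refine (ae_restrict_iff' measurableSet_Ioo).2 (Eventually.of_forall fun s hs => ?_)
        have hts : t0 < s := hr.trans_lt hs.1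
        have hDs := hD s ⟨hs.1.le, hs.2⟩
        have hε : 0 ≤ ε := (abs_nonneg _).trans hDs
        by_cases hsS : s ∈ S
        · have := norm_deriv_le_of_lipschitzOn (Ici_mem_nhds hts) hΔL
          rw [indicator_of_mem hsS]
          have hp : 0 ≤ L * ε := by positivity
          push_cast at this
          linarith
        · rw [indicator_of_notMem hsS, add_zero]
          have hlt : ε < |b s - X s| := by
            simpa [hS, max_eq_right hts.le] using hsS
          have hXY : ∀ F : ℝ → ℝ, LipschitzWith L F → HasDerivAt X (F (X s)) s →
              HasDerivAt Y (F (Y s)) s → ‖deriv Δ s‖ ≤ L * ε := by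
            intro F hF h1 h2
            rw [show deriv Δ s = _ from (h1.sub h2).deriv]
            exact (hF.dist_le_mul (X s) (Y s)).trans (by gcongr; exact hDs)
          rw [abs_le] at hDs
          rcases lt_abs.1 hlt with h | h
          · exact hXY F2 hF2 (hX.hasDerivAt_of_gt hts (by linarith))
              (hY.hasDerivAt_of_gt hts (by linarith))
          · exact hXY F1 hF1 (hX.hasDerivAt_of_lt hts (by linarith))
              (hY.hasDerivAt_of_lt hts (by linarith))
    _ = L * ε * (t - r) + (KX + KY) * volume.real (S ∩ Ioo r t) := by
        rw [integral_add (integrable_const _) hI, integral_indicator hSm]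
        simp [hrt, Measure.restrict_restrict hSm]
        ring
    _ ≤ _ := by
        gcongr
        · exact (measure_mono (t := Ico r t) fun s hs => hs.1).trans_lt measure_Ico_lt_top |>.ne
        · rintro s ⟨h1, h2⟩
          refine ⟨⟨h2.1.le, h2.2⟩, ?_⟩
          simpa [hS, max_eq_right (hr.trans h2.1.le)] using h1

/-- If two solutions differ, then just after the time at which they separate the barrier spends a
non-negligible amount of time close to the first one. -/
lemma IsLipSolutionOn.exists_occupation_of_ne {F1 F2 b X Y : ℝ → ℝ} {t0 x0 : ℝ} {L : NNReal}
    (hF1 : LipschitzWith L F1) (hF2 : LipschitzWith L F2) (hb : Continuous b)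
    (hX : IsLipSolutionOn F1 F2 b t0 x0 (Ici t0) X)
    (hY : IsLipSolutionOn F1 F2 b t0 x0 (Ici t0) Y) {t : ℝ} (ht : t0 ≤ t) (hne : X t ≠ Y t) :
    ∃ r, t0 ≤ r ∧ r < t ∧ ∃ C : ℕ, ∀ u, r < u → ∃ ε₀ > 0, ∀ ε, 0 < ε → ε < ε₀ →
      ENNReal.ofReal ε ≤ C * volume {s | s ∈ Ico r u ∧ |b s - X s| ≤ ε} := by
  obtain ⟨KX, hKX⟩ := hX.2.1
  obtain ⟨KY, hKY⟩ := hY.2.1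
  have hXYc : ContinuousOn (fun s => |X s - Y s|) (Ici t0) :=
    (hKX.continuousOn.sub hKY.continuousOn).abs
  set Z : Set ℝ := Icc t0 t ∩ (fun s => |X s - Y s|) ⁻¹' {0} with hZ
  have hZc : IsCompact Z :=
    isCompact_Icc.of_isClosed_subset
      ((hXYc.mono fun s hs => hs.1).preimage_isClosed_of_isClosed isClosed_Icc isClosed_singleton)
      inter_subset_left
  have hZne : Z.Nonempty := ⟨t0, ⟨le_rfl, ht⟩, by simp [hX.1, hY.1]⟩
  have hrZ := hZc.sSup_mem hZne
  set r := sSup Z with hr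
  have hXYr : X r = Y r := by simpa [sub_eq_zero] using hrZ.2
  have hrt : r < t := lt_of_le_of_ne hrZ.1.2 fun h => hne (h ▸ hXYr)
  have hpos : ∀ s ∈ Ioc r t, 0 < |X s - Y s| := by
    intro s hs
    refine (abs_nonneg _).lt_of_ne' fun h => ?_
    exact absurd (le_csSup hZc.bddAbove (⟨⟨hrZ.1.1.trans hs.1.le, hs.2⟩, h⟩ : s ∈ Z)) hs.1.not_ge
  refine ⟨r, hrZ.1.1, hrt, ⌈2 * ((KX : ℝ) + KY)⌉₊, fun u hu => ?_⟩
  set δ : ℝ := 1 / (2 * (L + 1)) with hδ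
  have hδ0 : 0 < δ := by positivity
  have hLδ : L * δ ≤ 1 / 2 := by
    rw [hδ, mul_one_div, div_le_div_iff₀ (by positivity) (by norm_num)]; linarith
  set v := min (min u t) (r + δ) with hv
  have hrv : r < v := lt_min (lt_min hu hrt) (by linarith)
  refine ⟨|X v - Y v|, hpos v ⟨hrv, (min_le_left _ _).trans (min_le_right _ _)⟩,
    fun ε hε hεv => ?_⟩
  set W : Set ℝ := Icc r v ∩ (fun s => |X s - Y s|) ⁻¹' Ici ε with hW
  have hWc : IsCompact W :=
    isCompact_Icc.of_isClosed_subset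
      ((hXYc.mono fun s hs => hrZ.1.1.trans hs.1).preimage_isClosed_of_isClosed isClosed_Icc
        isClosed_Ici) inter_subset_left
  have hτ := hWc.sInf_mem ⟨v, ⟨hrv.le, le_rfl⟩, hεv.le⟩
  set τ := sInf W with hτdef
  have hle := hX.abs_sub_le_add_occupation hF1 hF2 hb hY hKX hKY hrZ.1.1 hτ.1.1 hXYr (ε := ε) (by
    intro s hs
    by_contra! h
    exact absurd (csInf_le hWc.bddBelow (⟨⟨hs.1, hs.2.le.trans hτ.1.2⟩, h.le⟩ : s ∈ W))
      hs.2.not_ge)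
  have hετ : ε ≤ |X τ - Y τ| := hτ.2
  have hfin : volume {s | s ∈ Ico r u ∧ |b s - X s| ≤ ε} ≠ ⊤ :=
    ((measure_mono fun s hs => hs.1).trans_lt measure_Ico_lt_top).ne
  have hτu : τ ≤ u := hτ.1.2.trans ((min_le_left _ _).trans (min_le_left _ _))
  have hmono : volume.real {s | s ∈ Ico r τ ∧ |b s - X s| ≤ ε} ≤
      volume.real {s | s ∈ Ico r u ∧ |b s - X s| ≤ ε} :=
    measureReal_mono (fun s hs => ⟨⟨hs.1.1, hs.1.2.trans_le hτu⟩, hs.2⟩) hfin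
  have hτδ : τ - r ≤ δ := by linarith [hτ.1.2.trans (min_le_right (min u t) (r + δ))]
  have h1 : L * ε * (τ - r) ≤ ε / 2 := by
    calc L * ε * (τ - r) ≤ L * ε * δ := by gcongr
      _ = (L * δ) * ε := by ring
      _ ≤ 1 / 2 * ε := by gcongr
      _ = _ := by ring
  have h2 : ((KX : ℝ) + KY) * volume.real {s | s ∈ Ico r τ ∧ |b s - X s| ≤ ε} ≤
      (KX + KY) * volume.real {s | s ∈ Ico r u ∧ |b s - X s| ≤ ε} := by gcongr
  have h3 : 2 * ((KX : ℝ) + KY) * volume.real {s | s ∈ Ico r u ∧ |b s - X s| ≤ ε} ≤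
      ⌈2 * ((KX : ℝ) + KY)⌉₊ * volume.real {s | s ∈ Ico r u ∧ |b s - X s| ≤ ε} := by
    gcongr; exact Nat.le_ceil _
  rw [← ENNReal.ofReal_toReal hfin, ← ENNReal.ofReal_natCast,
    ← ENNReal.ofReal_mul (by positivity)]
  exact ENNReal.ofReal_le_ofReal (by simp only [measureReal_def] at *; linarith)

section Existence

open scoped Topology

variable {Ω : Type*} {mΩ : MeasurableSpace Ω}

lemma lipschitzWith_integral_max {h : ℝ → ℝ} (hc : Continuous h) {C : NNReal}
    (hC : ∀ s, |h s| ≤ C) (t0 x0 : ℝ) :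
    LipschitzWith C fun t => x0 + ∫ s in t0..max t0 t, h s := by
  refine LipschitzWith.of_dist_le_mul fun t s => ?_
  rw [dist_add_left, dist_eq_norm, intervalIntegral.integral_interval_sub_left
    (hc.intervalIntegrable _ _) (hc.intervalIntegrable _ _)]
  refine (intervalIntegral.norm_integral_le_of_norm_le_const fun r _ => hC r).trans ?_
  gcongr
  simpa [Real.dist_eq, max_comm t0] using abs_max_sub_max_le_abs t s t0

lemma measurable_intervalIntegral_of_continuous {u : ℝ → Ω → ℝ} {a b : ℝ} (hab : a ≤ b)
    (hc : ∀ ω, Continuous fun s => u s ω) (hm : ∀ s ∈ Icc a b, Measurable (u s)) :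
    Measurable fun ω => ∫ s in a..b, u s ω := by
  have hclamp : Measurable (Function.uncurry fun (s : ℝ) ω => u (projIcc a b hab s) ω) :=
    measurable_uncurry_of_continuous_of_measurable
      (fun ω => (hc ω).comp (continuous_subtype_val.comp continuous_projIcc))
      fun s => hm _ (projIcc a b hab s).2
  have heq : (fun ω => ∫ s in a..b, u s ω) =
      fun ω => ∫ s, u (projIcc a b hab s) ω ∂volume.restrict (Ioc a b) := by
    ext ω
    rw [intervalIntegral.integral_of_le hab]
    refine setIntegral_congr_fun measurableSet_Ioc fun s hs => ?_
    simp only [projIcc_of_mem hab (Ioc_subset_Icc_self hs)]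
  rw [heq]
  exact (hclamp.stronglyMeasurable.integral_prod_left).measurable

/-- The Picard iterates for the random equation `dX/dt = g (X t) (B t)`, frozen before `t0`. -/
noncomputable def picardIterate (g : ℝ → ℝ → ℝ) (B : ℝ → Ω → ℝ) (t0 x0 : ℝ) : ℕ → ℝ → Ω → ℝ
  | 0 => fun _ _ => x0
  | n + 1 => fun t ω =>
      x0 + ∫ s in t0..max t0 t, g (picardIterate g B t0 x0 n s ω) (B s ω)

section Picard

variable {g : ℝ → ℝ → ℝ} {B : ℝ → Ω → ℝ} {C K : NNReal}

lemma lipschitzWith_picardIterate (hg : Continuous (Function.uncurry g))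
    (hB : ∀ ω, Continuous fun t => B t ω) (hC : ∀ x y, |g x y| ≤ C) (t0 x0 : ℝ) (n : ℕ) (ω : Ω) :
    LipschitzWith C fun t => picardIterate g B t0 x0 n t ω := by
  induction n with
  | zero => exact (LipschitzWith.const x0).weaken zero_le
  | succ n ih =>
    exact lipschitzWith_integral_max (hg.comp (ih.continuous.prodMk (hB ω)))
      (fun s => hC _ _) t0 x0

lemma measurable_picardIterate (hg : Continuous (Function.uncurry g))
    (hB : ∀ ω, Continuous fun t => B t ω) (hC : ∀ x y, |g x y| ≤ C) {t0 x0 : ℝ}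
    {ℱ : Filtration ℝ mΩ} (hBm : ∀ s t, t0 ≤ s → s ≤ t → Measurable[ℱ t] (B s)) (n : ℕ) (t : ℝ) :
    Measurable[ℱ t] (picardIterate g B t0 x0 n t) := by
  induction n generalizing t with
  | zero => exact measurable_const
  | succ n ih =>
    refine Measurable.const_add ?_ x0
    rcases le_total t t0 with h | h
    · simp only [max_eq_left h, intervalIntegral.integral_same]
      exact measurable_const
    · simp only [max_eq_right h]
      refine @measurable_intervalIntegral_of_continuous Ω (ℱ t) _ t0 t h (fun ω => ?_)
        fun s hs => ?_
      · exact hg.comp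
          ((lipschitzWith_picardIterate hg hB hC t0 x0 n ω).continuous.prodMk (hB ω))
      · exact hg.measurable.comp (((ih s).mono (ℱ.mono hs.2) le_rfl).prodMk (hBm s t hs.1 hs.2))

lemma dist_picardIterate_succ_le (hg : Continuous (Function.uncurry g))
    (hB : ∀ ω, Continuous fun t => B t ω) (hC : ∀ x y, |g x y| ≤ C)
    (hK : ∀ y, LipschitzWith K fun x => g x y) (t0 x0 : ℝ) (n : ℕ) (t : ℝ) (ω : Ω) :
    |picardIterate g B t0 x0 n t ω - picardIterate g B t0 x0 (n + 1) t ω| ≤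
      C * Real.exp (2 * (K + 1) * (max t0 t - t0)) / 2 ^ n := by
  have hcont := fun n => (lipschitzWith_picardIterate hg hB hC t0 x0 n ω).continuous
  induction n generalizing t with
  | zero =>
    have h1 : |∫ s in t0..max t0 t, g x0 (B s ω)| ≤ C * |max t0 t - t0| := by
      rw [← Real.norm_eq_abs (∫ _ in _.._, _)]
      exact intervalIntegral.norm_integral_le_of_norm_le_const fun r _ => hC _ _
    have h0 : 0 ≤ max t0 t - t0 := sub_nonneg.2 (le_max_left _ _)
    rw [abs_of_nonneg h0] at h1
    simp only [picardIterate, sub_add_cancel_left, abs_neg, pow_zero, div_one]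
    refine h1.trans ?_
    gcongr
    have := Real.add_one_le_exp (2 * ((K : ℝ) + 1) * (max t0 t - t0))
    nlinarith [mul_nonneg K.coe_nonneg h0]
  | succ n ih =>
    have hle : t0 ≤ max t0 t := le_max_left _ _
    have hint : ∀ m, IntervalIntegrable (fun s => g (picardIterate g B t0 x0 m s ω) (B s ω))
        volume t0 (max t0 t) := fun m =>
      (hg.comp ((hcont m).prodMk (hB ω))).intervalIntegrable _ _
    rw [picardIterate, picardIterate, add_sub_add_left_eq_sub,
      ← intervalIntegral.integral_sub (hint n) (hint (n + 1)), ← Real.norm_eq_abs]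
    have hder : ∀ s, HasDerivAt
        (fun s => (C : ℝ) * Real.exp (2 * (K + 1) * (s - t0)) / 2 ^ (n + 1))
        ((K + 1) * (C * Real.exp (2 * (K + 1) * (s - t0)) / 2 ^ n)) s := by
      intro s
      have := (((((hasDerivAt_id s).sub_const t0).const_mul (2 * ((K : ℝ) + 1))).exp).const_mul
        (C : ℝ)).div_const (2 ^ (n + 1))
      refine this.congr_deriv ?_
      simp only [id]
      field_simp
      ring
    have hcd : Continuous fun s : ℝ =>
        ((K : ℝ) + 1) * (C * Real.exp (2 * (K + 1) * (s - t0)) / 2 ^ n) := by fun_prop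
    refine (intervalIntegral.norm_integral_le_of_norm_le hle
      (Eventually.of_forall fun s hs => ?_) (hcd.intervalIntegrable _ _)).trans ?_
    · refine ((hK (B s ω)).dist_le_mul _ _).trans ?_
      have := ih s
      rw [max_eq_right hs.1.le] at this
      rw [Real.dist_eq]
      have hp : 0 ≤ C * Real.exp (2 * (K + 1) * (s - t0)) / 2 ^ n := by positivity
      have h2 := mul_le_mul_of_nonneg_left this K.coe_nonneg
      nlinarith
    · rw [intervalIntegral.integral_eq_sub_of_hasDerivAt (fun s _ => hder s)
        (hcd.intervalIntegrable _ _)]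
      have : 0 ≤ C * Real.exp (2 * (K + 1) * (t0 - t0)) / 2 ^ (n + 1) := by positivity
      linarith

/-- A random equation with bounded Lipschitz drift has an adapted solution. -/
lemma exists_adapted_integral_solution (hg : Continuous (Function.uncurry g))
    (hB : ∀ ω, Continuous fun t => B t ω) (hC : ∀ x y, |g x y| ≤ C)
    (hK : ∀ y, LipschitzWith K fun x => g x y) (t0 x0 : ℝ)
    {ℱ : Filtration ℝ mΩ} (hBm : ∀ s t, t0 ≤ s → s ≤ t → Measurable[ℱ t] (B s)) :
    ∃ X : ℝ → Ω → ℝ, (∀ t, Measurable[ℱ t] (X t)) ∧ (∀ ω, LipschitzWith C fun t => X t ω) ∧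
      ∀ t ω, X t ω = x0 + ∫ s in t0..max t0 t, g (X s ω) (B s ω) := by
  have hlip := lipschitzWith_picardIterate hg hB hC t0 x0
  have hconv : ∀ t ω, ∃ y, Tendsto (fun n => picardIterate g B t0 x0 n t ω) atTop (𝓝 y) := by
    intro t ω
    refine cauchySeq_tendsto_of_complete (cauchySeq_of_le_geometric_two
      (C := 2 * (C * Real.exp (2 * (K + 1) * (max t0 t - t0)))) fun n => ?_)
    rw [mul_div_cancel_left₀ _ two_ne_zero]
    exact dist_picardIterate_succ_le hg hB hC hK t0 x0 n t ω
  choose X hX using hconv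
  refine ⟨X, fun t => ?_, fun ω => ?_, fun t ω => ?_⟩
  · exact @measurable_of_tendsto_metrizable Ω ℝ (ℱ t) _ _ _ _ _ _
      (fun n => measurable_picardIterate hg hB hC hBm n t)
      (tendsto_pi_nhds.2 (hX t))
  · refine LipschitzWith.of_dist_le_mul fun s t => ?_
    exact le_of_tendsto ((hX s ω).dist (hX t ω))
      (Eventually.of_forall fun n => (hlip n ω).dist_le_mul s t)
  · refine tendsto_nhds_unique ((tendsto_add_atTop_iff_nat 1).2 (hX t ω)) ?_
    simp only [picardIterate]
    refine Tendsto.const_add x0 ?_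
    refine intervalIntegral.tendsto_integral_filter_of_dominated_convergence (fun _ => (C : ℝ))
      (Eventually.of_forall fun n => ?_) (Eventually.of_forall fun n => ?_)
      intervalIntegrable_const (Eventually.of_forall fun s _ => ?_)
    · exact (hg.comp ((hlip n ω).continuous.prodMk (hB ω))).aestronglyMeasurable
    · exact Eventually.of_forall fun s _ => hC _ _
    · exact ((hK (B s ω)).continuous.tendsto _).comp (hX s ω)

end Picard

lemma hasDerivWithinAt_Ici_of_integral_eq {h X : ℝ → ℝ} {t0 x0 : ℝ} (hc : Continuous h)
    (hX : ∀ t, X t = x0 + ∫ s in t0..max t0 t, h s) {t : ℝ} (ht : t0 ≤ t) :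
    HasDerivWithinAt X (h t) (Ici t) t := by
  have h1 : HasDerivAt (fun u => x0 + ∫ s in t0..u, h s) (h t) t :=
    (hc.integral_hasStrictDerivAt t0 t).hasDerivAt.const_add x0
  refine h1.hasDerivWithinAt.congr (fun u hu => ?_) ?_
  · rw [hX, max_eq_right (ht.trans hu)]
  · rw [hX, max_eq_right ht]

/-- Strict comparison for one-dimensional equations. -/
lemma le_of_integral_eq_of_drift_lt {h k : ℝ → ℝ → ℝ} {X Y : ℝ → ℝ} {t0 x0 : ℝ}
    (hh : Continuous fun s => h (X s) s) (hk : Continuous fun s => k (Y s) s)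
    (hX : ∀ t, X t = x0 + ∫ s in t0..max t0 t, h (X s) s)
    (hY : ∀ t, Y t = x0 + ∫ s in t0..max t0 t, k (Y s) s)
    (hXc : Continuous X) (hYc : Continuous Y) (hlt : ∀ x s, h x s < k x s) (t : ℝ) :
    X t ≤ Y t := by
  rcases le_total t t0 with ht | ht
  · rw [hX, hY, max_eq_left ht]; simp
  · refine image_le_of_deriv_right_lt_deriv_boundary' (a := t0) (b := t) hXc.continuousOn
      (fun s hs => hasDerivWithinAt_Ici_of_integral_eq hh hX hs.1) ?_ hYc.continuousOn
      (fun s hs => hasDerivWithinAt_Ici_of_integral_eq hk hY hs.1) (fun s _ hs => ?_)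
      ⟨ht, le_rfl⟩
    · rw [hX, hY]; simp
    · rw [hs]; exact hlt _ _

/-- A Lipschitz approximation from above of the discontinuous drift `F1` on `x > y`, `F2` on
`x < y`. -/
noncomputable def approxDrift (F1 F2 : ℝ → ℝ) (k x y : ℝ) : ℝ :=
  min (max (F2 x) (max (F1 x) (F2 x) - k * max (y - x) 0))
    (max (F1 x) (max (F1 x) (F2 x) - k * max (x - y) 0))

section ApproxDrift

variable {F1 F2 : ℝ → ℝ} {M : ℝ}

lemma continuous_approxDrift (h1 : Continuous F1) (h2 : Continuous F2) (k : ℝ) :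
    Continuous (Function.uncurry (approxDrift F1 F2 k)) := by
  unfold approxDrift Function.uncurry
  fun_prop

lemma lipschitzWith_approxDrift {L : NNReal} (h1 : LipschitzWith L F1) (h2 : LipschitzWith L F2)
    (k : NNReal) (y : ℝ) : LipschitzWith (L + k) fun x => approxDrift F1 F2 k x y := by
  have hm : LipschitzWith L fun x => max (F1 x) (F2 x) := by simpa using h1.max h2
  have hk : LipschitzWith k fun z : ℝ => (k : ℝ) * z := by
    refine LipschitzWith.of_dist_le_mul fun a b => ?_
    rw [Real.dist_eq, Real.dist_eq, ← mul_sub, abs_mul, abs_of_nonneg k.coe_nonneg]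
  have ha : LipschitzWith k fun x : ℝ => (k : ℝ) * max (y - x) 0 := by
    have := (LipschitzWith.const y).sub LipschitzWith.id (α := ℝ)
    simpa [Function.comp_def] using hk.comp (this.max_const 0)
  have hb : LipschitzWith k fun x : ℝ => (k : ℝ) * max (x - y) 0 := by
    have := (LipschitzWith.id (α := ℝ)).sub (LipschitzWith.const y)
    simpa [Function.comp_def] using hk.comp (this.max_const 0)
  have := (h2.max (hm.sub ha)).min (h1.max (hm.sub hb))
  simpa [max_eq_right (le_self_add : L ≤ L + k), approxDrift] using this

lemma abs_approxDrift_le (h1 : ∀ y, |F1 y| ≤ M) (h2 : ∀ y, |F2 y| ≤ M) {k : ℝ} (hk : 0 ≤ k)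
    (x y : ℝ) : |approxDrift F1 F2 k x y| ≤ M := by
  have hF1 := abs_le.1 (h1 x)
  have hF2 := abs_le.1 (h2 x)
  have ha : 0 ≤ k * max (x - y) 0 := mul_nonneg hk (le_max_right _ _)
  have hb : 0 ≤ k * max (y - x) 0 := mul_nonneg hk (le_max_right _ _)
  have hm : max (F1 x) (F2 x) ≤ M := max_le hF1.2 hF2.2
  refine abs_le.2 ⟨le_min (hF2.1.trans (le_max_left _ _)) (hF1.1.trans (le_max_left _ _)), ?_⟩
  exact (min_le_left _ _).trans (max_le hF2.2 (by linarith))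

lemma approxDrift_anti {k l : ℝ} (hkl : k ≤ l) (x y : ℝ) :
    approxDrift F1 F2 l x y ≤ approxDrift F1 F2 k x y := by
  have ha := mul_le_mul_of_nonneg_right hkl (le_max_right (x - y) 0)
  have hb := mul_le_mul_of_nonneg_right hkl (le_max_right (y - x) 0)
  unfold approxDrift
  gcongr

lemma approxDrift_eq_of_gt (h1 : ∀ y, |F1 y| ≤ M) (h2 : ∀ y, |F2 y| ≤ M) {k x y : ℝ}
    (hxy : y < x) (hk : 2 * M ≤ k * (x - y)) : approxDrift F1 F2 k x y = F1 x := by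
  have hF1 := abs_le.1 (h1 x)
  have hF2 := abs_le.1 (h2 x)
  have hm : max (F1 x) (F2 x) ≤ M := max_le hF1.2 hF2.2
  unfold approxDrift
  rw [max_eq_right (by linarith : y - x ≤ 0), max_eq_left (by linarith : 0 ≤ x - y),
    mul_zero, sub_zero, max_eq_right (le_max_right (F1 x) (F2 x)),
    max_eq_left (by linarith : max (F1 x) (F2 x) - k * (x - y) ≤ F1 x),
    min_eq_right (le_max_left _ _)]

lemma approxDrift_eq_of_lt (h1 : ∀ y, |F1 y| ≤ M) (h2 : ∀ y, |F2 y| ≤ M) {k x y : ℝ}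
    (hxy : x < y) (hk : 2 * M ≤ k * (y - x)) : approxDrift F1 F2 k x y = F2 x := by
  have hF1 := abs_le.1 (h1 x)
  have hF2 := abs_le.1 (h2 x)
  have hm : max (F1 x) (F2 x) ≤ M := max_le hF1.2 hF2.2
  unfold approxDrift
  rw [max_eq_right (by linarith : x - y ≤ 0), max_eq_left (by linarith : 0 ≤ y - x),
    mul_zero, sub_zero, max_eq_right (le_max_left (F1 x) (F2 x)),
    max_eq_left (by linarith : max (F1 x) (F2 x) - k * (y - x) ≤ F2 x),
    min_eq_left (le_max_right _ _)]

lemma tendsto_approxDrift_of_gt (h1 : ∀ y, |F1 y| ≤ M) (h2 : ∀ y, |F2 y| ≤ M) {u : ℕ → ℝ}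
    {x y : ℝ} (hF : Continuous F1) (hu : Tendsto u atTop (𝓝 x)) (hxy : y < x) :
    Tendsto (fun n : ℕ => approxDrift F1 F2 n (u n) y) atTop (𝓝 (F1 x)) := by
  have hk : Tendsto (fun n : ℕ => (n : ℝ) * (u n - y)) atTop atTop :=
    tendsto_natCast_atTop_atTop.atTop_mul_pos (sub_pos.2 hxy) (hu.sub_const y)
  refine ((hF.tendsto x).comp hu).congr' ?_
  filter_upwards [hk.eventually_ge_atTop (2 * M), hu.eventually_const_lt hxy] with n hn hn'
  exact (approxDrift_eq_of_gt h1 h2 hn' hn).symm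

lemma tendsto_approxDrift_of_lt (h1 : ∀ y, |F1 y| ≤ M) (h2 : ∀ y, |F2 y| ≤ M) {u : ℕ → ℝ}
    {x y : ℝ} (hF : Continuous F2) (hu : Tendsto u atTop (𝓝 x)) (hxy : x < y) :
    Tendsto (fun n : ℕ => approxDrift F1 F2 n (u n) y) atTop (𝓝 (F2 x)) := by
  have hk : Tendsto (fun n : ℕ => (n : ℝ) * (y - u n)) atTop atTop :=
    tendsto_natCast_atTop_atTop.atTop_mul_pos (sub_pos.2 hxy) (hu.const_sub y)
  refine ((hF.tendsto x).comp hu).congr' ?_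
  filter_upwards [hk.eventually_ge_atTop (2 * M), hu.eventually_lt_const hxy] with n hn hn'
  exact (approxDrift_eq_of_lt h1 h2 hn' hn).symm

end ApproxDrift

/-- If the drifts converge on an open set of times, then the limit of the solutions solves the
limit equation there. -/
lemma hasDerivWithinAt_of_tendsto_drift {h : ℕ → ℝ → ℝ} {Z : ℕ → ℝ → ℝ} {X f : ℝ → ℝ}
    {t0 x0 C : ℝ} (hc : ∀ n, Continuous (h n)) (hC : ∀ n s, |h n s| ≤ C)
    (hZ : ∀ n t, Z n t = x0 + ∫ s in t0..max t0 t, h n s)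
    (hlim : ∀ t, Tendsto (fun n => Z n t) atTop (𝓝 (X t))) (hf : Continuous f)
    {U : Set ℝ} (hU : IsOpen U) (hlimU : ∀ s ∈ U, Tendsto (fun n => h n s) atTop (𝓝 (f s)))
    {t : ℝ} (ht : t0 ≤ t) (htU : t ∈ U) : HasDerivWithinAt X (f t) (Ici t0) t := by
  obtain ⟨δ, hδ, hball⟩ := Metric.isOpen_iff.1 hU t htU
  have hder : HasDerivAt (fun u => X t + ∫ s in t..u, f s) (f t) t :=
    (hf.integral_hasStrictDerivAt t t).hasDerivAt.const_add (X t)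
  refine hder.hasDerivWithinAt.congr_of_eventuallyEq ?_ (by simp)
  filter_upwards [self_mem_nhdsWithin, mem_nhdsWithin_of_mem_nhds (Metric.ball_mem_nhds t hδ)]
    with u hu hut
  have hsub : uIcc t u ⊆ Metric.ball t δ :=
    (convex_ball t δ).ordConnected.uIcc_subset (Metric.mem_ball_self hδ) hut
  have h1 : Tendsto (fun n => ∫ s in t..u, h n s) atTop (𝓝 (∫ s in t..u, f s)) := by
    refine intervalIntegral.tendsto_integral_filter_of_dominated_convergence (fun _ => C)
      (Eventually.of_forall fun n => (hc n).aestronglyMeasurable)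
      (Eventually.of_forall fun n => Eventually.of_forall fun s _ => hC n s)
      intervalIntegrable_const (Eventually.of_forall fun s hs => ?_)
    exact hlimU s (hball (hsub (uIoc_subset_uIcc hs)))
  have h2 : ∀ n, ∫ s in t..u, h n s = Z n u - Z n t := by
    intro n
    rw [hZ, hZ, max_eq_right ht, max_eq_right (mem_Ici.1 hu), add_sub_add_left_eq_sub,
      intervalIntegral.integral_interval_sub_left ((hc n).intervalIntegrable _ _)
      ((hc n).intervalIntegrable _ _)]
  simp only [h2] at h1
  have := tendsto_nhds_unique h1 ((hlim u).sub (hlim t))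
  linarith

/-- The equation has a solution, for every path, which is adapted. -/
lemma exists_adapted_isLipSolutionOn {F1 F2 : ℝ → ℝ} {M : ℝ}
    (hF1b : ∀ y, |F1 y| ≤ M) (hF2b : ∀ y, |F2 y| ≤ M)
    (hF1lip : LipschitzWith (Real.toNNReal M) F1) (hF2lip : LipschitzWith (Real.toNNReal M) F2)
    {B : ℝ → Ω → ℝ} (hB : ∀ ω, Continuous fun t => B t ω) (t0 x0 : ℝ)
    {ℱ : Filtration ℝ mΩ} (hBm : ∀ s t, t0 ≤ s → s ≤ t → Measurable[ℱ t] (B s)) :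
    ∃ X : ℝ → Ω → ℝ, (∀ t, Measurable[ℱ t] (X t)) ∧
      (∀ ω, LipschitzWith (Real.toNNReal M) fun t => X t ω) ∧
      ∀ ω, IsLipSolutionOn F1 F2 (fun t => B t ω) t0 x0 (Ici t0) fun t => X t ω := by
  have hM : 0 ≤ M := (abs_nonneg _).trans (hF1b 0)
  set e : ℕ → ℝ := fun n => 1 / ((n : ℝ) + 1) with he
  have he0 : ∀ n, 0 ≤ e n := fun n => by simp only [he]; positivity
  have hetend : Tendsto e atTop (𝓝 0) := tendsto_one_div_add_atTop_nhds_zero_nat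
  set g : ℕ → ℝ → ℝ → ℝ := fun n x y => approxDrift F1 F2 n x y + e n with hg
  have hgc : ∀ n, Continuous (Function.uncurry (g n)) := fun n =>
    (continuous_approxDrift hF1lip.continuous hF2lip.continuous n).add continuous_const
  have hgb : ∀ n x y, |g n x y| ≤ (M + e n).toNNReal := by
    intro n x y
    rw [Real.coe_toNNReal _ (add_nonneg hM (he0 n))]
    refine (abs_add_le _ _).trans ?_
    rw [abs_of_nonneg (he0 n)]
    gcongr
    exact abs_approxDrift_le hF1b hF2b n.cast_nonneg x y
  have hgK : ∀ (n : ℕ) y, LipschitzWith (M.toNNReal + n) fun x => g n x y := by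
    intro n y
    simpa [hg] using (lipschitzWith_approxDrift hF1lip hF2lip n y).add (LipschitzWith.const (e n))
  choose Z hZm hZL hZ using fun n =>
    exists_adapted_integral_solution (hgc n) hB (hgb n) (hgK n) t0 x0 hBm
  have hdc : ∀ n ω, Continuous fun s => g n (Z n s ω) (B s ω) := fun n ω =>
    (hgc n).comp ((hZL n ω).continuous.prodMk (hB ω))
  have hgb' : ∀ n x y, |g n x y| ≤ M + 1 := by
    intro n x y
    refine (hgb n x y).trans ?_
    rw [Real.coe_toNNReal _ (add_nonneg hM (he0 n))]
    have : e n ≤ 1 := by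
      simp only [he]; rw [div_le_one (by positivity)]; linarith [n.cast_nonneg (α := ℝ)]
    linarith
  have hanti : ∀ t ω, Antitone fun n => Z n t ω := by
    refine fun t ω => antitone_nat_of_succ_le fun n => ?_
    refine le_of_integral_eq_of_drift_lt (h := fun x s => g (n + 1) x (B s ω))
      (k := fun x s => g n x (B s ω)) (hdc (n + 1) ω) (hdc n ω) (fun t => hZ (n + 1) t ω)
      (fun t => hZ n t ω) (hZL (n + 1) ω).continuous (hZL n ω).continuous (fun x s => ?_) t
    refine add_lt_add_of_le_of_lt (approxDrift_anti (by simp) _ _) ?_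
    simp only [he]
    exact one_div_lt_one_div_of_lt (by positivity) (by simp)
  have hbdd : ∀ t ω, BddBelow (range fun n => Z n t ω) := by
    refine fun t ω => ⟨x0 - (M + 1) * |max t0 t - t0|, ?_⟩
    rintro _ ⟨n, rfl⟩
    have : |∫ s in t0..max t0 t, g n (Z n s ω) (B s ω)| ≤ (M + 1) * |max t0 t - t0| := by
      rw [← Real.norm_eq_abs (∫ _ in _.._, _)]
      exact intervalIntegral.norm_integral_le_of_norm_le_const fun s _ => hgb' n _ _
    have h2 := hZ n t ω
    have := (abs_le.1 this).1
    simp only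
    linarith
  set X : ℝ → Ω → ℝ := fun t ω => ⨅ n, Z n t ω with hX
  have hlim : ∀ t ω, Tendsto (fun n => Z n t ω) atTop (𝓝 (X t ω)) := fun t ω =>
    tendsto_atTop_ciInf (hanti t ω) (hbdd t ω)
  have hXL : ∀ ω, LipschitzWith (Real.toNNReal M) fun t => X t ω := by
    refine fun ω => LipschitzWith.of_dist_le_mul fun s t => ?_
    rw [Real.coe_toNNReal _ hM]
    have hconst : Tendsto (fun n => (M + e n) * dist s t) atTop (𝓝 ((M + 0) * dist s t)) :=
      (hetend.const_add M).mul_const _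
    rw [add_zero] at hconst
    refine le_of_tendsto_of_tendsto' ((hlim s ω).dist (hlim t ω)) hconst fun n => ?_
    have := (hZL n ω).dist_le_mul s t
    rwa [Real.coe_toNNReal _ (add_nonneg hM (he0 n))] at this
  refine ⟨X, fun t => ?_, hXL, fun ω => ⟨?_, ⟨_, (hXL ω).lipschitzOnWith⟩, ?_, ?_⟩⟩
  · exact @measurable_of_tendsto_metrizable Ω ℝ (ℱ t) _ _ _ _ _ _ (fun n => hZm n t)
      (tendsto_pi_nhds.2 (hlim t))
  · refine tendsto_nhds_unique (hlim t0 ω) ?_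
    simp [hZ _ t0 ω]
  · intro t ht hlt
    refine hasDerivWithinAt_of_tendsto_drift (h := fun n s => g n (Z n s ω) (B s ω))
      (f := fun s => F1 (X s ω)) (U := {s | B s ω < X s ω}) (fun n => hdc n ω)
      (fun n s => hgb' n _ _) (fun n t => hZ n t ω) (fun t => hlim t ω)
      (hF1lip.continuous.comp (hXL ω).continuous) (isOpen_lt (hB ω) (hXL ω).continuous)
      (fun s hs => ?_) ht hlt
    simpa using (tendsto_approxDrift_of_gt hF1b hF2b hF1lip.continuous (hlim s ω) hs).add hetend
  · intro t ht hlt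
    refine hasDerivWithinAt_of_tendsto_drift (h := fun n s => g n (Z n s ω) (B s ω))
      (f := fun s => F2 (X s ω)) (U := {s | X s ω < B s ω}) (fun n => hdc n ω)
      (fun n s => hgb' n _ _) (fun n t => hZ n t ω) (fun t => hlim t ω)
      (hF2lip.continuous.comp (hXL ω).continuous) (isOpen_lt (hXL ω).continuous (hB ω))
      (fun s hs => ?_) ht hlt
    simpa using (tendsto_approxDrift_of_lt hF1b hF2b hF2lip.continuous (hlim s ω) hs).add hetend

end Existence

section Occupation

open scoped ENNReal

lemma lintegral_Ioo_le_add_ofReal {f : ℝ → ℝ≥0∞} (hf1 : ∀ s, f s ≤ 1) (a s t : ℝ) :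
    ∫⁻ r in Ioo a t, f r ≤ (∫⁻ r in Ioo a s, f r) + ENNReal.ofReal (t - s) := by
  have hsub : Ioo a t ⊆ Ioo a s ∪ Icc s t := fun r hr =>
    (lt_or_ge r s).imp (fun h => ⟨hr.1, h⟩) fun h => ⟨h, hr.2.le⟩
  refine (lintegral_mono_set hsub).trans ((lintegral_union_le _ _ _).trans ?_)
  gcongr
  refine (lintegral_mono hf1).trans ?_
  simp

/-- The chain rule `m ^ (k + 1) ≤ C ∫ m' m ^ k`, up to a constant. -/
lemma lintegral_Ioo_pow_succ_le {f : ℝ → ℝ≥0∞} (hf : Measurable f) (hf1 : ∀ s, f s ≤ 1)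
    {a t : ℝ} (hat : a ≤ t) (k : ℕ) :
    (∫⁻ r in Ioo a t, f r) ^ (k + 1) ≤
      2 ^ (k + 1) * ∫⁻ s in Ioo a t, f s * (∫⁻ r in Ioo a s, f r) ^ k := by
  set m : ℝ → ℝ≥0∞ := fun s => ∫⁻ r in Ioo a s, f r with hm
  have hfin : ∀ s, m s ≠ ∞ := fun s =>
    ((lintegral_mono hf1).trans_lt (by simp)).ne
  have hLip : LipschitzWith 1 fun s => (m s).toReal := by
    refine LipschitzWith.of_le_add_mul 1 fun t s => ?_
    rw [NNReal.coe_one, one_mul, ← ENNReal.toReal_ofReal (dist_nonneg (x := t) (y := s)),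
      ← ENNReal.toReal_add (hfin s) ENNReal.ofReal_ne_top]
    refine ENNReal.toReal_mono (ENNReal.add_ne_top.2 ⟨hfin s, ENNReal.ofReal_ne_top⟩) ?_
    refine (lintegral_Ioo_le_add_ofReal hf1 a s t).trans ?_
    gcongr
    exact le_abs_self _
  have hma : m a = 0 := by simp [hm]
  obtain ⟨s, hs, hs2⟩ := intermediate_value_Icc hat hLip.continuous.continuousOn
    (show (m t).toReal / 2 ∈ Icc (m a).toReal (m t).toReal by
      rw [hma]
      constructor
      · simp only [ENNReal.toReal_zero]; positivity
      · linarith [ENNReal.toReal_nonneg (a := m t)])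
  have hms : m s = m t / 2 := by
    rw [← ENNReal.toReal_eq_toReal_iff' (hfin s) (ENNReal.div_ne_top (hfin t) two_ne_zero)]
    simpa using hs2
  have hrest : m t / 2 ≤ ∫⁻ r in Ioo s t, f r := by
    have h1 : m t ≤ m s + ∫⁻ r in Ioo s t, f r := by
      have hsub : Ioo a t ⊆ Ioo a s ∪ Ico s t := fun r hr =>
        (lt_or_ge r s).imp (fun h => ⟨hr.1, h⟩) fun h => ⟨h, hr.2⟩
      rw [setLIntegral_congr (Ioo_ae_eq_Ico (a := s) (b := t))]
      exact (lintegral_mono_set hsub).trans (lintegral_union_le _ _ _)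
    rw [hms] at h1
    have h2 : m t / 2 + m t / 2 ≤ m t / 2 + ∫⁻ r in Ioo s t, f r := by
      rwa [ENNReal.add_halves]
    exact (ENNReal.add_le_add_iff_left (ENNReal.div_ne_top (hfin t) two_ne_zero)).1 h2
  have hmain : (m t / 2) ^ (k + 1) ≤ ∫⁻ r in Ioo a t, f r * m r ^ k := by
    calc (m t / 2) ^ (k + 1) ≤ (∫⁻ r in Ioo s t, f r) * m s ^ k := by
          rw [pow_succ', hms]; gcongr
      _ = ∫⁻ r in Ioo s t, f r * m s ^ k := by rw [lintegral_mul_const _ hf]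
      _ ≤ ∫⁻ r in Ioo s t, f r * m r ^ k := by
          refine setLIntegral_mono' measurableSet_Ioo fun r hr => ?_
          gcongr
          exact lintegral_mono_set (Ioo_subset_Ioo_right hr.1.le)
      _ ≤ _ := lintegral_mono_set (Ioo_subset_Ioo_left hs.1)
  calc m t ^ (k + 1) = 2 ^ (k + 1) * (m t / 2) ^ (k + 1) := by
        rw [← mul_pow, ENNReal.mul_div_cancel two_ne_zero ENNReal.ofNat_ne_top]
    _ ≤ _ := by gcongr

lemma lintegral_lintegral_kernel_mul_le {κ G : ℝ → ℝ≥0∞} (hκ : Measurable κ) (hG : Measurable G)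
    (a b : ℝ) :
    ∫⁻ s in Ioo a b, ∫⁻ r in Ioo a s, κ (s - r) * G r ≤
      (∫⁻ u in Ioo 0 (b - a), κ u) * ∫⁻ r in Ioo a b, G r := by
  set κ' : ℝ → ℝ≥0∞ := (Ioo 0 (b - a)).indicator κ with hκ'
  have hκ'm : Measurable κ' := hκ.indicator measurableSet_Ioo
  calc ∫⁻ s in Ioo a b, ∫⁻ r in Ioo a s, κ (s - r) * G r
      ≤ ∫⁻ s in Ioo a b, ∫⁻ r in Ioo a b, κ' (s - r) * G r := by
        refine setLIntegral_mono' measurableSet_Ioo fun s hs => ?_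
        refine le_trans (setLIntegral_mono' measurableSet_Ioo fun r hr => ?_)
          (lintegral_mono_set (Ioo_subset_Ioo_right hs.2.le))
        have hmem : s - r ∈ Ioo 0 (b - a) := ⟨by linarith [hr.2], by linarith [hr.1, hs.2]⟩
        rw [hκ', indicator_of_mem hmem]
    _ ≤ ∫⁻ s, ∫⁻ r in Ioo a b, κ' (s - r) * G r := setLIntegral_le_lintegral _ _
    _ = ∫⁻ r in Ioo a b, ∫⁻ s, κ' (s - r) * G r := by
        refine lintegral_lintegral_swap (Measurable.aemeasurable ?_)
        exact (hκ'm.comp (measurable_fst.sub measurable_snd)).mul (hG.comp measurable_snd)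
    _ = ∫⁻ r in Ioo a b, (∫⁻ u in Ioo 0 (b - a), κ u) * G r := by
        refine lintegral_congr fun r => ?_
        have hκr : Measurable fun s => κ' (s - r) := hκ'm.comp (measurable_id.sub_const r)
        rw [lintegral_mul_const _ hκr, lintegral_sub_right_eq_self κ' r, hκ',
          lintegral_indicator measurableSet_Ioo]
    _ = _ := lintegral_const_mul _ hG

/-- A bound on a conditional probability, tested against nonnegative functions. -/
lemma lintegral_indicator_mul_le_of_condExp_le {Ω : Type*} {m mΩ : MeasurableSpace Ω}
    {P : Measure Ω} [IsProbabilityMeasure P] (hm : m ≤ mΩ) {E : Set Ω} (hE : MeasurableSet E)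
    {c : ℝ}
    (hc : ∀ᵐ ω ∂P, (P[E.indicator fun _ => (1 : ℝ) | m]) ω ≤ c)
    {Z : Ω → ℝ≥0∞} (hZ : Measurable[m] Z) :
    ∫⁻ ω, E.indicator (fun _ => (1 : ℝ≥0∞)) ω * Z ω ∂P ≤ ENNReal.ofReal c * ∫⁻ ω, Z ω ∂P := by
  have hset : ∀ G, MeasurableSet[m] G → P (G ∩ E) ≤ ENNReal.ofReal c * P G := by
    intro G hG
    have hint : Integrable (E.indicator fun _ => (1 : ℝ)) P :=
      (integrable_const (1 : ℝ)).indicator hE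
    have h1 : ∫ ω in G, (P[E.indicator fun _ => (1 : ℝ) | m]) ω ∂P ≤ ∫ _ in G, c ∂P :=
      integral_mono_ae integrable_condExp.integrableOn (integrable_const _) (ae_restrict_of_ae hc)
    rw [setIntegral_condExp hm hint hG, integral_indicator hE] at h1
    simp only [integral_const, smul_eq_mul, mul_one, measureReal_restrict_apply_univ,
      Measure.restrict_restrict hE] at h1
    rw [← ENNReal.ofReal_toReal (measure_ne_top P (G ∩ E)),
      ← ENNReal.ofReal_toReal (measure_ne_top P G), ← ENNReal.ofReal_mul' ENNReal.toReal_nonneg]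
    refine ENNReal.ofReal_le_ofReal ?_
    rw [inter_comm, mul_comm]
    exact h1
  have hle : (P.restrict E).trim hm ≤ ENNReal.ofReal c • P.trim hm := by
    refine Measure.le_iff.2 fun G hG => ?_
    rw [trim_measurableSet_eq hm hG, Measure.restrict_apply (hm G hG), Measure.smul_apply,
      trim_measurableSet_eq hm hG]
    exact hset G hG
  calc ∫⁻ ω, E.indicator (fun _ => (1 : ℝ≥0∞)) ω * Z ω ∂P = ∫⁻ ω in E, Z ω ∂P := by
        rw [← lintegral_indicator hE]
        refine lintegral_congr fun ω => ?_
        by_cases h : ω ∈ E <;> simp [h]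
    _ = ∫⁻ ω, Z ω ∂(P.restrict E).trim hm := (lintegral_trim hm hZ).symm
    _ ≤ ∫⁻ ω, Z ω ∂(ENNReal.ofReal c • P.trim hm) := lintegral_mono' hle le_rfl
    _ = _ := by rw [lintegral_smul_measure, lintegral_trim hm hZ, smul_eq_mul]

variable {Ω : Type*} {mΩ : MeasurableSpace Ω}

lemma measurable_lintegral_Ioo {f : ℝ → Ω → ℝ≥0∞} {a b : ℝ} (hab : a ≤ b)
    (hm : Measurable (Function.uncurry fun (s : Icc a b) ω => f s ω)) :
    Measurable fun ω => ∫⁻ s in Ioo a b, f s ω := by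
  have heq : (fun ω => ∫⁻ s in Ioo a b, f s ω) =
      fun ω => ∫⁻ s in Ioo a b, f (projIcc a b hab s) ω := by
    ext ω
    refine setLIntegral_congr_fun measurableSet_Ioo fun s hs => ?_
    simp only [projIcc_of_mem hab (Ioo_subset_Icc_self hs)]
  rw [heq]
  refine Measurable.lintegral_prod_right' (f := fun p : Ω × ℝ => f (projIcc a b hab p.2) p.1) ?_
  exact hm.comp (((continuous_projIcc (h := hab)).measurable.comp measurable_snd).prodMk
    measurable_fst)

lemma measurable_uncurry_lintegral_Ioo {f : ℝ → Ω → ℝ≥0∞} (hf : Measurable (Function.uncurry f))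
    (a : ℝ) : Measurable (Function.uncurry fun s ω => ∫⁻ r in Ioo a s, f r ω) := by
  have heq : (Function.uncurry fun s ω => ∫⁻ r in Ioo a s, f r ω) =
      fun p : ℝ × Ω => ∫⁻ r, {q : (ℝ × Ω) × ℝ | a < q.2 ∧ q.2 < q.1.1}.indicator
        (fun q => f q.2 q.1.2) (p, r) := by
    ext p
    simp only [Function.uncurry_def]
    rw [← lintegral_indicator measurableSet_Ioo]
    rfl
  rw [heq]
  refine Measurable.lintegral_prod_right' (Measurable.indicator ?_ ?_)
  · exact hf.comp (measurable_snd.prodMk (measurable_snd.comp measurable_fst))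
  · exact (measurableSet_lt measurable_const measurable_snd).inter
      (measurableSet_lt measurable_snd (measurable_fst.comp measurable_fst))

/-- Moment bounds for an additive functional whose conditional intensity is bounded by a
kernel. -/
lemma lintegral_lintegral_Ioo_pow_le {P : Measure Ω} [IsProbabilityMeasure P]
    {ℱ : Filtration ℝ mΩ} {f : ℝ → Ω → ℝ≥0∞} (hf : Measurable (Function.uncurry f))
    (hf1 : ∀ s ω, f s ω ≤ 1) {κ : ℝ → ℝ≥0∞} (hκ : Measurable κ) {a b : ℝ} (hab : a ≤ b)
    (hadapt : ∀ s, a ≤ s → Measurable[ℱ s] fun ω => ∫⁻ r in Ioo a s, f r ω)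
    (hfadapt : ∀ s, a ≤ s → Measurable[ℱ s] (f s))
    (hcond : ∀ r s, a ≤ r → r < s → ∀ Z : Ω → ℝ≥0∞, Measurable[ℱ r] Z →
      ∫⁻ ω, f s ω * Z ω ∂P ≤ κ (s - r) * ∫⁻ ω, Z ω ∂P) (k : ℕ) :
    ∫⁻ ω, (∫⁻ s in Ioo a b, f s ω) ^ (k + 1) ∂P ≤
      2 ^ ((k + 1) * (k + 1)) * (∫⁻ u in Ioo 0 (b - a), κ u) ^ (k + 1) := by
  set K := ∫⁻ u in Ioo 0 (b - a), κ u with hK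
  set m : ℝ → Ω → ℝ≥0∞ := fun s ω => ∫⁻ r in Ioo a s, f r ω with hm
  have hmm : Measurable (Function.uncurry m) := measurable_uncurry_lintegral_Ioo hf a
  have hfs : ∀ ω, Measurable fun s => f s ω := fun ω => hf.of_uncurry_right
  have hgm : ∀ j : ℕ, Measurable (Function.uncurry fun s ω => f s ω * m s ω ^ j) := fun j =>
    hf.mul (hmm.pow_const j)
  set G : ℕ → ℝ → ℝ≥0∞ := fun j s => ∫⁻ ω, f s ω * m s ω ^ j ∂P with hG
  have hGm : ∀ j, Measurable (G j) := fun j => (hgm j).lintegral_prod_right'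
  have hstep : ∀ j (t : ℝ), a ≤ t → ∀ F : Ω → ℝ≥0∞, Measurable F →
      ∫⁻ ω, F ω * m t ω ^ (j + 1) ∂P ≤
        2 ^ (j + 1) * ∫⁻ r in Ioo a t, ∫⁻ ω, F ω * (f r ω * m r ω ^ j) ∂P := by
    intro j t hat F hF
    have hFm : Measurable (Function.uncurry fun ω r => F ω * (f r ω * m r ω ^ j)) :=
      (hF.comp measurable_fst).mul ((hgm j).comp measurable_swap)
    have hFm' : Measurable fun ω => ∫⁻ r in Ioo a t, F ω * (f r ω * m r ω ^ j) :=
      hFm.lintegral_prod_right'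
    rw [← lintegral_lintegral_swap hFm.aemeasurable, ← lintegral_const_mul _ hFm']
    refine lintegral_mono fun ω => ?_
    have hfm : Measurable fun r => f r ω * m r ω ^ j := (hgm j).of_uncurry_right
    simp only
    rw [lintegral_const_mul _ hfm, mul_left_comm]
    gcongr
    exact lintegral_Ioo_pow_succ_le (hfs ω) (fun s => hf1 s ω) hat j
  have hI : ∀ j : ℕ, ∫⁻ s in Ioo a b, G j s ≤ 2 ^ (j * j) * K ^ (j + 1) := by
    intro j
    induction j with
    | zero =>
      have h0 : ∫⁻ s in Ioo a b, G 0 s ≤ ∫⁻ s in Ioo a b, κ (s - a) := by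
        refine setLIntegral_mono' measurableSet_Ioo fun s hs => ?_
        simpa [hG] using hcond a s le_rfl hs.1 (fun _ => 1) measurable_const
      have h1 : ∫⁻ s in Ioo a b, κ (s - a) = K := by
        rw [hK, ← lintegral_indicator measurableSet_Ioo, ← lintegral_indicator measurableSet_Ioo,
          ← lintegral_sub_right_eq_self ((Ioo 0 (b - a)).indicator κ) a]
        refine lintegral_congr fun s => ?_
        simp [indicator]
      simpa using h0.trans_eq h1
    | succ j ih =>
      calc ∫⁻ s in Ioo a b, G (j + 1) s
          ≤ ∫⁻ s in Ioo a b, 2 ^ (j + 1) * ∫⁻ r in Ioo a s, κ (s - r) * G j r := by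
            refine setLIntegral_mono' measurableSet_Ioo fun s hs => ?_
            refine (hstep j s hs.1.le (f s) hf.of_uncurry_left).trans ?_
            refine mul_le_mul' le_rfl (setLIntegral_mono' measurableSet_Ioo fun r hr => ?_)
            exact hcond r s hr.1.le hr.2 _
              ((hfadapt r hr.1.le).mul ((hadapt r hr.1.le).pow_const j))
        _ = 2 ^ (j + 1) * ∫⁻ s in Ioo a b, ∫⁻ r in Ioo a s, κ (s - r) * G j r :=
            lintegral_const_mul' _ _ (by simp)
        _ ≤ 2 ^ (j + 1) * (K * (2 ^ (j * j) * K ^ (j + 1))) := by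
            gcongr
            refine (lintegral_lintegral_kernel_mul_le hκ (hGm j) a b).trans ?_
            gcongr
        _ = 2 ^ (j * j + j + 1) * K ^ (j + 1 + 1) := by ring
        _ ≤ 2 ^ ((j + 1) * (j + 1)) * K ^ (j + 1 + 1) := by
            gcongr
            · norm_num
            · nlinarith
  calc ∫⁻ ω, m b ω ^ (k + 1) ∂P ≤ 2 ^ (k + 1) * ∫⁻ r in Ioo a b, G k r := by
        simpa using hstep k b hab (fun _ => 1) measurable_const
    _ ≤ 2 ^ (k + 1) * (2 ^ (k * k) * K ^ (k + 1)) := by gcongr; exact hI k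
    _ = 2 ^ (k * k + k + 1) * K ^ (k + 1) := by ring
    _ ≤ _ := by
        gcongr
        · norm_num
        · nlinarith

lemma lintegral_Ioo_rpow_kernel {c γ h : ℝ} (hc : 0 ≤ c) (hγ : γ < 1) (hh : 0 ≤ h) :
    ∫⁻ u in Ioo 0 h, ENNReal.ofReal (c / u ^ γ) =
      ENNReal.ofReal (c * (h ^ (1 - γ) / (1 - γ))) := by
  have hI : IntervalIntegrable (fun u : ℝ => u ^ (-γ)) volume 0 h :=
    intervalIntegral.intervalIntegrable_rpow' (by linarith)
  have hcongr : ∀ u ∈ Ioo 0 h, ENNReal.ofReal (c / u ^ γ) = ENNReal.ofReal (c * u ^ (-γ)) := by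
    intro u hu
    rw [Real.rpow_neg hu.1.le, div_eq_mul_inv]
  have hIo : IntegrableOn (fun u : ℝ => c * u ^ (-γ)) (Ioo 0 h) :=
    ((intervalIntegrable_iff_integrableOn_Ioo_of_le hh).1 hI).const_mul c
  rw [setLIntegral_congr_fun measurableSet_Ioo hcongr, ← ofReal_integral_eq_lintegral_ofReal hIo,
    integral_const_mul, ← integral_Ioc_eq_integral_Ioo, ← intervalIntegral.integral_of_le hh,
    integral_rpow (Or.inl (by linarith))]
  · rw [Real.zero_rpow (by linarith), sub_zero, neg_add_eq_sub]
  · refine (ae_restrict_iff' measurableSet_Ioo).2 (Eventually.of_forall fun u hu => ?_)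
    exact mul_nonneg hc (Real.rpow_nonneg hu.1.le _)

end Occupation

section DenseOccupation

open scoped ENNReal

variable {Ω : Type*} {mΩ : MeasurableSpace Ω}

lemma volume_setOf_mem_Ico_and_abs_sub_le {f : ℝ → ℝ} (hf : Measurable f) (a ε lo hi : ℝ) :
    volume {s | s ∈ Ico lo hi ∧ |f s - a| ≤ ε} =
      ∫⁻ s in Ioo lo hi, (Icc (a - ε) (a + ε)).indicator (fun _ => (1 : ℝ≥0∞)) (f s) := by
  have hS : MeasurableSet (f ⁻¹' Icc (a - ε) (a + ε)) := hf measurableSet_Icc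
  have hset : {s | s ∈ Ico lo hi ∧ |f s - a| ≤ ε} = f ⁻¹' Icc (a - ε) (a + ε) ∩ Ico lo hi := by
    ext s
    simp only [mem_ofPred_eq, mem_inter_iff, mem_preimage, mem_Icc, abs_le]
    constructor
    · rintro ⟨h1, h2, h3⟩
      exact ⟨⟨by linarith, by linarith⟩, h1⟩
    · rintro ⟨⟨h2, h3⟩, h1⟩
      exact ⟨h1, by linarith, by linarith⟩
  have hind : (fun s => (Icc (a - ε) (a + ε)).indicator (fun _ => (1 : ℝ≥0∞)) (f s)) =
      (f ⁻¹' Icc (a - ε) (a + ε)).indicator 1 := rfl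
  rw [hset, hind, setLIntegral_congr (Ioo_ae_eq_Ico (a := lo) (b := hi)),
    lintegral_indicator_one hS, Measure.restrict_apply hS]

/-- A process with conditional densities bounded by `c / (t - s) ^ γ` is unlikely to spend time
of order `ε` in an `ε`-neighbourhood of a level during a short time interval. -/
lemma measure_le_mul_occupation_le {B : ℝ → Ω → ℝ} (hBmeas : ∀ t, Measurable (B t))
    (hBcont : ∀ ω, Continuous fun t => B t ω) {P : Measure Ω} [IsProbabilityMeasure P]
    {ℱ : Filtration ℝ mΩ} {t0 c γ : ℝ}
    (hBm : ∀ s t, t0 ≤ s → s ≤ t → Measurable[ℱ t] (B s)) (hc : 0 ≤ c) (hγ : γ < 1)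
    (hdens : ∀ s t : ℝ, t0 ≤ s → s < t → ∀ A : Set ℝ, MeasurableSet A → volume A < ⊤ →
      ∀ᵐ ω ∂P, (P[(fun ω => A.indicator (fun _ => (1 : ℝ)) (B t ω)) | ℱ s]) ω ≤
        c / (t - s) ^ γ * (volume A).toReal)
    (k C : ℕ) (a : ℝ) {lo hi ε : ℝ} (hlo : t0 ≤ lo) (hhi : lo ≤ hi) (hε : 0 < ε) :
    P {ω | ENNReal.ofReal ε ≤ C * volume {s | s ∈ Ico lo hi ∧ |B s ω - a| ≤ ε}} ≤
      ENNReal.ofReal (C * 2 ^ (k + 1) * (2 * c / (1 - γ)) * (hi - lo) ^ (1 - γ)) ^ (k + 1) := by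
  set A := Icc (a - ε) (a + ε) with hA
  set f : ℝ → Ω → ℝ≥0∞ := fun s ω => A.indicator (fun _ => 1) (B s ω) with hf
  have hind : Measurable (A.indicator fun _ => (1 : ℝ≥0∞)) :=
    measurable_const.indicator measurableSet_Icc
  have hfm : Measurable (Function.uncurry f) :=
    hind.comp (measurable_uncurry_of_continuous_of_measurable hBcont hBmeas)
  have hf1 : ∀ s ω, f s ω ≤ 1 := fun s ω => indicator_le_self' (fun _ _ => zero_le) _
  have hvol : (volume A).toReal = 2 * ε := by
    rw [hA, Real.volume_Icc, ENNReal.toReal_ofReal (by linarith)]; ring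
  have hmom := lintegral_lintegral_Ioo_pow_le (P := P) (ℱ := ℱ) hfm hf1
    (κ := fun u => ENNReal.ofReal (c * (2 * ε) / u ^ γ)) (by fun_prop) hhi
    (fun s hs => measurable_lintegral_Ioo (mΩ := ℱ s) hs
      (hind.comp (measurable_uncurry_of_continuous_of_measurable
        (u := fun (r : Icc lo s) ω => B r ω)
        (fun ω => (hBcont ω).comp continuous_subtype_val)
        fun r => hBm r s (hlo.trans r.2.1) r.2.2)))
    (fun s hs => hind.comp (hBm s s (hlo.trans hs) le_rfl))
    (fun r s hr hrs Z hZ => by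
      refine lintegral_indicator_mul_le_of_condExp_le (ℱ.le r)
        (hBmeas s (measurableSet_Icc : MeasurableSet A)) ?_ hZ
      filter_upwards [hdens r s (hlo.trans hr) hrs A measurableSet_Icc (by simp [hA])] with ω hω
      rw [hvol] at hω
      exact hω.trans_eq (by ring)) k
  rw [lintegral_Ioo_rpow_kernel (by positivity) hγ (sub_nonneg.2 hhi)] at hmom
  have hVm : Measurable fun ω => ∫⁻ s in Ioo lo hi, f s ω :=
    (hfm.comp measurable_swap).lintegral_prod_right'
  have hmarkov := mul_meas_ge_le_lintegral (μ := P)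
    (((hVm.const_mul (C : ℝ≥0∞)).pow_const (k + 1))) (ENNReal.ofReal ε ^ (k + 1))
  have hε0 : ENNReal.ofReal ε ^ (k + 1) ≠ 0 := pow_ne_zero _ (by simpa using hε)
  have hεt : ENNReal.ofReal ε ^ (k + 1) ≠ ∞ := ENNReal.pow_ne_top ENNReal.ofReal_ne_top
  have hγ' : 0 < 1 - γ := by linarith
  refine (ENNReal.mul_le_mul_iff_right hε0 hεt).1 ?_
  calc ENNReal.ofReal ε ^ (k + 1) *
        P {ω | ENNReal.ofReal ε ≤ C * volume {s | s ∈ Ico lo hi ∧ |B s ω - a| ≤ ε}}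
      ≤ ∫⁻ ω, ((C : ℝ≥0∞) * ∫⁻ s in Ioo lo hi, f s ω) ^ (k + 1) ∂P := by
        refine le_trans (mul_le_mul' le_rfl (measure_mono fun ω hω => ?_)) hmarkov
        rw [mem_ofPred_eq, volume_setOf_mem_Ico_and_abs_sub_le (hBcont ω).measurable] at hω
        exact pow_le_pow_left' hω _
    _ ≤ (C : ℝ≥0∞) ^ (k + 1) * (2 ^ ((k + 1) * (k + 1)) *
          ENNReal.ofReal (c * (2 * ε) * ((hi - lo) ^ (1 - γ) / (1 - γ))) ^ (k + 1)) := by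
        simp only [mul_pow]
        rw [lintegral_const_mul _ (hVm.pow_const _)]
        gcongr
    _ = ENNReal.ofReal ε ^ (k + 1) *
          ENNReal.ofReal (C * 2 ^ (k + 1) * (2 * c / (1 - γ)) * (hi - lo) ^ (1 - γ)) ^ (k + 1) := by
        rw [pow_mul, ← mul_pow, ← mul_pow, ← mul_pow, ← ENNReal.ofReal_mul hε.le,
          ← ENNReal.ofReal_natCast C, ← ENNReal.ofReal_ofNat 2, ← ENNReal.ofReal_pow (by norm_num),
          ← ENNReal.ofReal_mul (by positivity), ← ENNReal.ofReal_mul (by positivity)]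
        congr 2
        field_simp

/-- At every scale `T / N` some cell of the partition of `[lo, lo + T)` into `N` cells carries
an occupation of order `ε` of the `ε`-neighbourhood of `a`, for all small `ε = 1 / (n + 1)`. -/
def HasDenseOccupation (C : ℕ) (a lo T : ℝ) (f : ℝ → ℝ) : Prop :=
  ∀ N : ℕ, 0 < N → ∃ i < N, ∃ n0 : ℕ, ∀ n : ℕ, n0 ≤ n →
    ENNReal.ofReal (1 / (n + 1)) ≤ C * volume {s | s ∈ Ico (lo + i * (T / N))
      (lo + (i + 1) * (T / N)) ∧ |f s - a| ≤ 1 / (n + 1)}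

lemma measure_hasDenseOccupation_eq_zero {P : Measure Ω} {B : ℝ → Ω → ℝ} {C : ℕ} {a lo T β : ℝ}
    {k : ℕ} {D : ℝ} (hD : 0 ≤ D) (hT : 0 ≤ T) (hk : 1 < β * (k + 1))
    (hocc : ∀ u v ε : ℝ, lo ≤ u → u ≤ v → 0 < ε →
      P {ω | ENNReal.ofReal ε ≤ C * volume {s | s ∈ Ico u v ∧ |B s ω - a| ≤ ε}} ≤
        ENNReal.ofReal (D * (v - u) ^ β) ^ (k + 1)) :
    P {ω | HasDenseOccupation C a lo T fun s => B s ω} = 0 := by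
  set E : ℝ → ℝ → ℕ → Set Ω := fun u v n => {ω | ENNReal.ofReal (1 / (n + 1)) ≤
    C * volume {s | s ∈ Ico u v ∧ |B s ω - a| ≤ 1 / (n + 1)}} with hE
  have hbound : ∀ N : ℕ, P {ω | HasDenseOccupation C a lo T fun s => B s ω} ≤
      ENNReal.ofReal ((D * T ^ β) ^ (k + 1) * ((N + 1 : ℕ) : ℝ) ^ (-(β * (k + 1) - 1))) := by
    intro N
    have hN : (0 : ℝ) < (N + 1 : ℕ) := by positivity
    have hcell : ∀ i : ℕ, P (⋃ n0 : ℕ, ⋂ n ≥ n0, E (lo + i * (T / (N + 1 : ℕ)))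
        (lo + (i + 1) * (T / (N + 1 : ℕ))) n) ≤
        ENNReal.ofReal (D * (T / (N + 1 : ℕ)) ^ β) ^ (k + 1) := by
      intro i
      rw [Monotone.measure_iUnion]
      · refine iSup_le fun n0 => (measure_mono (iInter₂_subset n0 le_rfl)).trans ?_
        refine (hocc _ _ (1 / (n0 + 1)) ?_ ?_ (by positivity)).trans_eq ?_
        · have : 0 ≤ i * (T / (N + 1 : ℕ)) := by positivity
          linarith
        · have : 0 ≤ T / (N + 1 : ℕ) := by positivity
          linarith
        · congr 4; ring
      · intro n m hnm
        exact biInter_subset_biInter_left fun j hj => le_trans hnm hj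
    calc P {ω | HasDenseOccupation C a lo T fun s => B s ω}
        ≤ P (⋃ i ∈ Finset.range (N + 1), ⋃ n0 : ℕ, ⋂ n ≥ n0, E (lo + i * (T / (N + 1 : ℕ)))
          (lo + (i + 1) * (T / (N + 1 : ℕ))) n) := by
          refine measure_mono fun ω hω => ?_
          obtain ⟨i, hi, n0, hn⟩ := hω (N + 1) N.succ_pos
          simp only [mem_iUnion, mem_iInter]
          exact ⟨i, Finset.mem_range.2 hi, n0, hn⟩
      _ ≤ ∑ i ∈ Finset.range (N + 1), ENNReal.ofReal (D * (T / (N + 1 : ℕ)) ^ β) ^ (k + 1) :=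
          (measure_biUnion_finset_le _ _).trans (Finset.sum_le_sum fun i _ => hcell i)
      _ = _ := by
          rw [Finset.sum_const, Finset.card_range, nsmul_eq_mul, ← ENNReal.ofReal_natCast,
            ← ENNReal.ofReal_pow (by positivity), ← ENNReal.ofReal_mul hN.le]
          congr 1
          rw [Real.div_rpow hT hN.le, neg_sub, Real.rpow_sub hN, Real.rpow_one, Real.rpow_mul hN.le,
            mul_div_assoc', div_pow]
          norm_cast
          field_simp
  have hlim : Tendsto (fun N : ℕ => ENNReal.ofReal
      ((D * T ^ β) ^ (k + 1) * ((N + 1 : ℕ) : ℝ) ^ (-(β * (k + 1) - 1)))) atTop (nhds 0) := by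
    have h1 := ((tendsto_rpow_neg_atTop (sub_pos.2 hk)).comp
      (tendsto_natCast_atTop_atTop.comp (tendsto_add_atTop_nat 1))).const_mul
        ((D * T ^ β) ^ (k + 1))
    simpa using ENNReal.tendsto_ofReal h1
  exact le_antisymm (ge_of_tendsto' hlim hbound) zero_le

end DenseOccupation

section PathSpace

open scoped ENNReal

/-- A jointly measurable extension of a path on `[a, b]` to the real line, which reproduces
continuous paths. -/
noncomputable def pathExtend {a b : ℝ} (hab : a ≤ b) (w : Icc a b → ℝ) (s : ℝ) : ℝ :=
  limsup (fun n : ℕ => w (projIcc a b hab (⌊s * (n + 1)⌋ / (n + 1)))) atTop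

lemma measurable_uncurry_pathExtend {a b : ℝ} (hab : a ≤ b) :
    Measurable (Function.uncurry (pathExtend hab)) := by
  refine Measurable.limsup fun n => ?_
  have h1 : Measurable fun p : (Icc a b → ℝ) × ℤ => p.1 (projIcc a b hab (p.2 / (n + 1))) :=
    measurable_from_prod_countable_left fun z =>
      (measurable_pi_apply (projIcc a b hab (z / (n + 1))) : Measurable fun w : Icc a b → ℝ => w _)
  have h2 : Measurable fun p : (Icc a b → ℝ) × ℝ => (p.1, ⌊p.2 * (n + 1)⌋) := by fun_prop
  exact h1.comp h2

lemma tendsto_floor_mul_div_natCast_add_one (s : ℝ) :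
    Tendsto (fun n : ℕ => (⌊s * (n + 1)⌋ : ℝ) / (n + 1)) atTop (nhds s) := by
  have h := tendsto_one_div_add_atTop_nhds_zero_nat (𝕜 := ℝ)
  refine tendsto_of_tendsto_of_tendsto_of_le_of_le
    (by simpa using h.const_sub s) tendsto_const_nhds (fun n => ?_) fun n => ?_
  · have hn : (0 : ℝ) < n + 1 := by positivity
    rw [le_div_iff₀ hn, sub_mul, inv_mul_cancel₀ hn.ne']
    exact (Int.sub_one_lt_floor _).le
  · have hn : (0 : ℝ) < n + 1 := by positivity
    rw [div_le_iff₀ hn]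
    exact Int.floor_le _

lemma pathExtend_restrict {a b : ℝ} (hab : a ≤ b) {f : ℝ → ℝ} (hf : Continuous f) {s : ℝ}
    (hs : s ∈ Icc a b) : pathExtend hab (fun u => f u) s = f s := by
  refine Tendsto.limsup_eq ?_
  have h := ((hf.comp (continuous_subtype_val.comp (continuous_projIcc (h := hab)))).tendsto s).comp
    (tendsto_floor_mul_div_natCast_add_one s)
  simpa [Function.comp_def, projIcc_of_mem hab hs] using h

lemma measurableSet_hasDenseOccupation_pathExtend {a b : ℝ} (hab : a ≤ b) (C : ℕ) (y lo T : ℝ) :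
    MeasurableSet {w | HasDenseOccupation C y lo T (pathExtend hab w)} := by
  have hvol : ∀ u v ε : ℝ, Measurable fun w : Icc a b → ℝ =>
      volume {s | s ∈ Ico u v ∧ |pathExtend hab w s - y| ≤ ε} := fun u v ε =>
    measurable_measure_prodMk_left (s := {p : (Icc a b → ℝ) × ℝ |
      p.2 ∈ Ico u v ∧ |pathExtend hab p.1 p.2 - y| ≤ ε})
      ((measurable_snd measurableSet_Ico).inter (measurableSet_le
        ((measurable_uncurry_pathExtend hab).sub_const y).abs measurable_const))
  simp only [HasDenseOccupation, ofPred_forall, ← exists_prop, ofPred_exists]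
  refine MeasurableSet.iInter fun N => MeasurableSet.iInter fun _ => MeasurableSet.iUnion fun i =>
    MeasurableSet.iUnion fun _ => MeasurableSet.iUnion fun n0 => MeasurableSet.iInter fun n =>
    MeasurableSet.iInter fun _ => measurableSet_le measurable_const ?_
  simp only [exists_prop]
  exact (hvol _ _ _).const_mul _

lemma hasDenseOccupation_congr {C : ℕ} {y lo T : ℝ} (hT : 0 ≤ T) {f g : ℝ → ℝ}
    (hfg : EqOn f g (Icc lo (lo + T))) :
    HasDenseOccupation C y lo T f ↔ HasDenseOccupation C y lo T g := by
  unfold HasDenseOccupation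
  refine forall₂_congr fun N hN => exists_congr fun i => and_congr_right fun hi =>
    exists_congr fun n0 => forall₂_congr fun n _ => ?_
  have hsub : Ico (lo + i * (T / N)) (lo + (i + 1) * (T / N)) ⊆ Icc lo (lo + T) := by
    have hN' : (0 : ℝ) < N := by exact_mod_cast hN
    have hi' : (i : ℝ) + 1 ≤ N := by exact_mod_cast hi
    have h0 : 0 ≤ T / N := by positivity
    have h1 : (i + 1) * (T / N) ≤ T :=
      (mul_le_mul_of_nonneg_right hi' h0).trans_eq (mul_div_cancel₀ T hN'.ne')
    have h2 : 0 ≤ i * (T / N) := by positivity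
    exact fun s hs => ⟨by linarith [hs.1], by linarith [hs.2]⟩
  have hset : {s | s ∈ Ico (lo + i * (T / N)) (lo + (i + 1) * (T / N)) ∧
      |f s - y| ≤ 1 / (n + 1)} = {s | s ∈ Ico (lo + i * (T / N)) (lo + (i + 1) * (T / N)) ∧
      |g s - y| ≤ 1 / (n + 1)} := by
    ext s
    exact and_congr_right fun hs => by rw [hfg (hsub hs)]
  rw [hset]

/-- Dense occupation of a level is a property of the law of a continuous process. -/
lemma measure_hasDenseOccupation_eq_zero_of_absolutelyContinuous {Ω : Type*}
    {mΩ : MeasurableSpace Ω} {P Q : Measure Ω} {U V : ℝ → Ω → ℝ} {C : ℕ} {y lo T : ℝ} (hT : 0 ≤ T)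
    (hUm : ∀ t, Measurable (U t)) (hUc : ∀ ω, Continuous fun t => U t ω)
    (hVm : ∀ t, Measurable (V t)) (hVc : ∀ ω, Continuous fun t => V t ω)
    (hac : P.map (fun ω (u : Icc lo (lo + T)) => U u ω) ≪
      Q.map (fun ω (u : Icc lo (lo + T)) => V u ω))
    (hV : Q {ω | HasDenseOccupation C y lo T fun s => V s ω} = 0) :
    P {ω | HasDenseOccupation C y lo T fun s => U s ω} = 0 := by
  have hab : lo ≤ lo + T := by linarith
  have hS := measurableSet_hasDenseOccupation_pathExtend hab C y lo T
  set S := {w | HasDenseOccupation C y lo T (pathExtend hab w)} with hSdef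
  have hpre : ∀ W : ℝ → Ω → ℝ, (∀ ω, Continuous fun t => W t ω) →
      (fun ω (u : Icc lo (lo + T)) => W u ω) ⁻¹' S =
        {ω | HasDenseOccupation C y lo T fun s => W s ω} := by
    intro W hW
    ext ω
    rw [mem_preimage, hSdef, mem_ofPred_eq, mem_ofPred_eq]
    exact hasDenseOccupation_congr hT fun s hs => pathExtend_restrict hab (hW ω) hs
  have hUm' : Measurable fun ω (u : Icc lo (lo + T)) => U u ω :=
    measurable_pi_lambda _ fun u => hUm u
  have hVm' : Measurable fun ω (u : Icc lo (lo + T)) => V u ω :=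
    measurable_pi_lambda _ fun u => hVm u
  have h0 : Q.map (fun ω (u : Icc lo (lo + T)) => V u ω) S = 0 := by
    rw [Measure.map_apply hVm' hS, hpre V hVc, hV]
  have h1 := hac h0
  rwa [Measure.map_apply hUm' hS, hpre U hUc] at h1

end PathSpace

section Uniqueness

lemma HasDenseOccupation.of_sub {C : ℕ} {a a' lo T : ℝ} {f g : ℝ → ℝ}
    (h : HasDenseOccupation C a lo T f) (hfg : ∀ s, f s - a = g s - a') :
    HasDenseOccupation C a' lo T g := by
  simpa only [HasDenseOccupation, hfg] using h

/-- If the noise does not densely occupy a solution, then this solution is unique. -/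
lemma IsLipSolutionOn.eqOn_of_not_hasDenseOccupation {F1 F2 b X Y : ℝ → ℝ} {t0 x0 : ℝ}
    {L : NNReal} (hX : IsLipSolutionOn F1 F2 b t0 x0 (Ici t0) X) (hF1 : LipschitzWith L F1)
    (hF2 : LipschitzWith L F2) (hb : Continuous b)
    (hY : IsLipSolutionOn F1 F2 b t0 x0 (Ici t0) Y)
    (hdense : ∀ C T : ℕ, ¬HasDenseOccupation C 0 t0 (T + 1) fun s => b s - X s) :
    EqOn X Y (Ici t0) := by
  intro t ht
  by_contra hne
  obtain ⟨r, hr, hrt, C, hC⟩ := IsLipSolutionOn.exists_occupation_of_ne hF1 hF2 hb hX hY ht hne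
  obtain ⟨T, hT⟩ := exists_nat_gt (t - t0)
  refine hdense C T fun N hN => ?_
  have hN' : (0 : ℝ) < N := by exact_mod_cast hN
  set h : ℝ := (T + 1) / N with hh
  have hpos : 0 < h := by positivity
  have hNh : N * h = T + 1 := mul_div_cancel₀ _ hN'.ne'
  have hdiv : 0 ≤ (r - t0) / h := div_nonneg (sub_nonneg.2 hr) hpos.le
  have hlow : ⌊(r - t0) / h⌋₊ * h ≤ r - t0 := (le_div_iff₀ hpos).1 (Nat.floor_le hdiv)
  have hup : r - t0 < (⌊(r - t0) / h⌋₊ + 1) * h := (div_lt_iff₀ hpos).1 (Nat.lt_floor_add_one _)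
  obtain ⟨ε₀, hε₀, hε⟩ := hC (t0 + (⌊(r - t0) / h⌋₊ + 1) * h) (by linarith)
  obtain ⟨n0, hn0⟩ := exists_nat_one_div_lt hε₀
  refine ⟨⌊(r - t0) / h⌋₊, ?_, n0, fun n hn => ?_⟩
  · rw [Nat.floor_lt hdiv, div_lt_iff₀ hpos, hNh]
    linarith
  · refine (hε _ (by positivity) ((Nat.one_div_le_one_div hn).trans_lt hn0)).trans ?_
    refine mul_le_mul' le_rfl (measure_mono fun s hs => ?_)
    refine ⟨⟨by linarith [hs.1.1], hs.1.2⟩, ?_⟩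
    rw [sub_zero]
    exact hs.2

end Uniqueness

/-- Theorem 2.5: if `F1, F2` are bounded Lipschitz functions and the continuous
process `B` has conditional densities bounded by `c1 (t-s)^{-γ}` and is mutually
absolutely continuous under adapted Lipschitz perturbations, then, almost surely,
equation (2.3) has a unique Lipschitz solution on `[t0, ∞)`. -/
theorem unique_lipschitz_solution_of_conditional_density_bound
    {Ω : Type*} [mΩ : MeasurableSpace Ω]
    (t0 x0 : ℝ) (F1 F2 : ℝ → ℝ) (M : ℝ)
    (hF1b : ∀ y, |F1 y| ≤ M) (hF2b : ∀ y, |F2 y| ≤ M)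
    (hF1lip : LipschitzWith (Real.toNNReal M) F1)
    (hF2lip : LipschitzWith (Real.toNNReal M) F2)
    (B : ℝ → Ω → ℝ) (hBmeas : ∀ t, Measurable (B t))
    (hBcont : ∀ ω, Continuous fun t => B t ω)
    -- the family of laws `Pm x = P^x` of the process conditioned to start at `x` at time `t0`
    (Pm : ℝ → Measure Ω) (hPprob : ∀ x, IsProbabilityMeasure (Pm x))
    (hPstart : ∀ x, ∀ᵐ ω ∂Pm x, B t0 ω = x)
    -- the natural filtration of `B`
    (ℱ : Filtration ℝ mΩ)
    (hℱ : ∀ t, ℱ t = ⨆ s ∈ Icc t0 t, MeasurableSpace.comap (B s) inferInstance)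
    -- (i) conditional density bound: `P(B_t ∈ dy | ℱ_s) ≤ c1 (t-s)^{-γ} dy`
    (c1 γ : ℝ) (hc1 : 0 < c1) (hγ : γ ∈ Ioo (0:ℝ) 1)
    (hdens : ∀ (x : ℝ) (s t : ℝ), t0 ≤ s → s < t →
      ∀ A : Set ℝ, MeasurableSet A → volume A < ⊤ →
      ∀ᵐ ω ∂Pm x,
        ((Pm x)[(fun ω => A.indicator (fun _ => (1:ℝ)) (B t ω)) | ℱ s]) ω ≤
          c1 / (t - s) ^ γ * (volume A).toReal)
    -- (ii) mutual absolute continuity under adapted Lipschitz perturbations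
    (hAC : ∀ A : ℝ → Ω → ℝ,
      (∀ t, Measurable[ℱ t] (A t)) →
      (∀ ω, A t0 ω = x0) →
      (∀ ω, LipschitzOnWith (Real.toNNReal M) (fun t => A t ω) (Ici t0)) →
      ∀ (x : ℝ) (s : ℝ), 0 < s →
        ((Pm x).map (fun ω (u : Icc t0 (t0 + s)) => B u ω + A u ω) ≪
          (Pm (x + x0)).map (fun ω (u : Icc t0 (t0 + s)) => B u ω)) ∧
        ((Pm (x + x0)).map (fun ω (u : Icc t0 (t0 + s)) => B u ω) ≪
          (Pm x).map (fun ω (u : Icc t0 (t0 + s)) => B u ω + A u ω))) :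
    -- conclusion: a.s. existence and uniqueness of a Lipschitz solution on `[t0, ∞)`
    ∀ x, ∀ᵐ ω ∂Pm x,
      (∃ X : ℝ → ℝ, IsLipSolutionOn F1 F2 (fun t => B t ω) t0 x0 (Ici t0) X) ∧
      (∀ X Y : ℝ → ℝ,
        IsLipSolutionOn F1 F2 (fun t => B t ω) t0 x0 (Ici t0) X →
        IsLipSolutionOn F1 F2 (fun t => B t ω) t0 x0 (Ici t0) Y →
        EqOn X Y (Ici t0)) := by
  have hBm : ∀ s t, t0 ≤ s → s ≤ t → Measurable[ℱ t] (B s) := by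
    intro s t hs hst
    rw [hℱ t]
    exact (comap_measurable (B s)).mono (le_iSup₂_of_le s ⟨hs, hst⟩ le_rfl) le_rfl
  obtain ⟨X, hXm, hXL, hX⟩ :=
    exists_adapted_isLipSolutionOn hF1b hF2b hF1lip hF2lip hBcont t0 x0 hBm
  intro x
  have hX_cont : ∀ ω, Continuous fun t => X t ω := fun ω => (hXL ω).continuous
  have hAm : ∀ t, Measurable[ℱ t] fun ω => 2 * x0 - X t ω := fun t =>
    (hXm t).const_sub (2 * x0)
  have hdense : ∀ᵐ ω ∂Pm x, ∀ C T : ℕ,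
      ¬HasDenseOccupation C (2 * x0) t0 (T + 1) fun s => B s ω + (2 * x0 - X s ω) := by
    refine ae_all_iff.2 fun C => ae_all_iff.2 fun T => ?_
    have hT : (0 : ℝ) < T + 1 := by positivity
    have hac := (hAC (fun t ω => 2 * x0 - X t ω) hAm (fun ω => by
        have h0 : X t0 ω = x0 := (hX ω).1
        simp only [h0]; ring)
      (fun ω => by
        have := (LipschitzWith.const (2 * x0)).sub (hXL ω)
        rw [zero_add] at this
        exact this.lipschitzOnWith) x (T + 1) hT).1
    have hprob := hPprob (x + x0)
    obtain ⟨k, hk⟩ := exists_nat_gt (1 / (1 - γ))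
    have hγ1 : 0 < 1 - γ := by linarith [hγ.2]
    have hk1 : 1 < (1 - γ) * (k + 1) := by
      rw [div_lt_iff₀ hγ1] at hk
      nlinarith
    have hzero : Pm (x + x0) {ω | HasDenseOccupation C (2 * x0) t0 (T + 1) fun s => B s ω} = 0 :=
      measure_hasDenseOccupation_eq_zero (k := k)
        (D := C * 2 ^ (k + 1) * (2 * c1 / (1 - γ))) (by positivity) hT.le hk1
        fun u v ε hu huv hε => measure_le_mul_occupation_le hBmeas hBcont hBm hc1.le hγ.2
          (hdens (x + x0)) k C (2 * x0) hu huv hε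
    have := measure_hasDenseOccupation_eq_zero_of_absolutelyContinuous
      (U := fun s ω => B s ω + (2 * x0 - X s ω)) hT.le
      (fun t => (hBmeas t).add ((hAm t).mono (ℱ.le t) le_rfl))
      (fun ω => (hBcont ω).add (continuous_const.sub (hX_cont ω))) hBmeas hBcont hac hzero
    rw [ae_iff]
    simpa only [not_not] using this
  filter_upwards [hdense] with ω hω
  have huniq : ∀ Y : ℝ → ℝ, IsLipSolutionOn F1 F2 (fun t => B t ω) t0 x0 (Ici t0) Y →
      EqOn (fun t => X t ω) Y (Ici t0) := fun Y hY =>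
    (hX ω).eqOn_of_not_hasDenseOccupation hF1lip hF2lip (hBcont ω) hY fun C T h =>
      hω C T (h.of_sub (by intro s; ring))
  exact ⟨⟨_, hX ω⟩, fun Y Z hY hZ => (huniq Y hY).symm.trans (huniq Z hZ)⟩
end

section
/- Let B_t be a continuous adapted process satisfying: there exist c > 0 and γ ∈ (0,1) such that P(B_t ∈ dy | F_s) ≤ c (t − s)^{−γ} dy for all y ∈ ℝ whenever s < t. Set δ = (1 − γ)/4. Let α ≥ 1, 0 < t ≤ 1, A > 0, and C_t = ∫_0^t 1_{(0 < B_s < A s^α)} ds. Then there exist constants c1, c2 > 0, independent of α and A, such that for all λ > 0, P(C_t > λ) ≤ c1 exp(−c2 λ α^δ / (A t^{α + 2δ})). -/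
open MeasureTheory ProbabilityTheory Filter Set

/-- A bounded power of `y` is dominated by the exponential. -/
lemma rpow_le_exp_self {y δ : ℝ} (hy : 0 < y) (hδ0 : 0 ≤ δ) (hδ1 : δ ≤ 1) :
    y ^ δ ≤ Real.exp y := by
  rw [Real.rpow_def_of_pos hy]
  apply Real.exp_le_exp.2
  have h := Real.log_le_sub_one_of_pos hy
  rcases le_total 0 (Real.log y) with h0 | h0
  · nlinarith
  · nlinarith [mul_nonneg hδ0 (neg_nonneg.2 h0)]

lemma rpow_le_mul_sub_rpow_neg {s t α δ : ℝ} (hs : 0 ≤ s) (hst : s < t) (hα : 1 ≤ α)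
    (hδ0 : 0 ≤ δ) (hδ1 : δ ≤ 1) :
    s ^ α ≤ t ^ (α + δ) * α ^ (-δ) * (t - s) ^ (-δ) := by
  have ht : 0 < t := hs.trans_lt hst
  have hα0 : 0 < α := by linarith
  have hx : s / t < 1 := (div_lt_one ht).2 hst
  have hy : 0 < α * (1 - s / t) := mul_pos hα0 (by linarith)
  have h1 : (s / t) ^ α ≤ Real.exp (-(α * (1 - s / t))) := by
    calc (s / t) ^ α ≤ (Real.exp (s / t - 1)) ^ α := by
          apply Real.rpow_le_rpow (by positivity) _ hα0.le
          linarith [Real.add_one_le_exp (s / t - 1)]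
      _ = _ := by rw [← Real.exp_mul]; congr 1; ring
  have h2 : Real.exp (-(α * (1 - s / t))) ≤ (α * (1 - s / t)) ^ (-δ) := by
    rw [Real.exp_neg, Real.rpow_neg hy.le]
    exact inv_anti₀ (by positivity) (rpow_le_exp_self hy hδ0 hδ1)
  have h3 : (α * (1 - s / t)) ^ (-δ) = t ^ δ * α ^ (-δ) * (t - s) ^ (-δ) := by
    have : α * (1 - s / t) = α * ((t - s) * t⁻¹) := by field_simp
    rw [this, Real.mul_rpow hα0.le (by have := sub_pos.2 hst; positivity),
      Real.mul_rpow (by linarith) (by positivity), Real.inv_rpow ht.le, Real.rpow_neg ht.le, inv_inv]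
    ring
  calc s ^ α = t ^ α * (s / t) ^ α := by
        rw [Real.div_rpow hs ht.le]; field_simp
    _ ≤ t ^ α * (t ^ δ * α ^ (-δ) * (t - s) ^ (-δ)) := by
        rw [← h3]; gcongr; exact h1.trans h2
    _ = _ := by rw [Real.rpow_add ht]; ring

lemma rpow_neg_mul_rpow_neg_le_add {a b γ δ : ℝ} (ha : 0 < a) (hb : 0 < b)
    (hγ : 0 ≤ γ) (hδ : 0 ≤ δ) :
    a ^ (-γ) * b ^ (-δ) ≤ a ^ (-(γ + δ)) + b ^ (-(γ + δ)) := by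
  rw [neg_add, Real.rpow_add ha, Real.rpow_add hb]
  rcases le_total a b with h | h
  · have : b ^ (-δ) ≤ a ^ (-δ) := Real.rpow_le_rpow_of_nonpos ha h (by linarith)
    have h2 : a ^ (-γ) * b ^ (-δ) ≤ a ^ (-γ) * a ^ (-δ) := by gcongr
    have : 0 ≤ b ^ (-γ) * b ^ (-δ) := by positivity
    linarith
  · have : a ^ (-γ) ≤ b ^ (-γ) := Real.rpow_le_rpow_of_nonpos hb h (by linarith)
    have h2 : a ^ (-γ) * b ^ (-δ) ≤ b ^ (-γ) * b ^ (-δ) := by gcongr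
    have : 0 ≤ a ^ (-γ) * a ^ (-δ) := by positivity
    linarith

/-- The integral of the singular kernel `(s - v)^{-γ}` against `s^α`, with the gain `α^{-δ}`. -/
lemma lintegral_rpow_div_sub_rpow_le {v t α γ δ : ℝ} (hv : 0 ≤ v) (hvt : v ≤ t) (ht0 : 0 < t)
    (ht1 : t ≤ 1) (hα : 1 ≤ α) (hγ : 0 < γ) (hδ0 : 0 < δ) (hδ : γ + 4 * δ = 1) :
    ∫⁻ s in Ioc v t, ENNReal.ofReal (s ^ α / (s - v) ^ γ) ≤
      ENNReal.ofReal (2 / (3 * δ) * (t ^ (α + 2 * δ) * α ^ (-δ))) := by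
  have hr : -1 < -(γ + δ) := by linarith
  have hI1 : IntervalIntegrable (fun s => (s - v) ^ (-(γ + δ))) volume v t := by
    have := (intervalIntegral.intervalIntegrable_rpow' (a := 0) (b := t - v) hr).comp_sub_right v
    simpa using this
  have hI2 : IntervalIntegrable (fun s => (t - s) ^ (-(γ + δ))) volume v t := by
    have := (intervalIntegral.intervalIntegrable_rpow' (a := t - v) (b := 0) hr).comp_sub_left t
    simpa using this
  have hE : -(γ + δ) + 1 = 3 * δ := by linarith
  have hbase : ∫ s in (0 : ℝ)..(t - v), s ^ (-(γ + δ)) = (t - v) ^ (3 * δ) / (3 * δ) := by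
    rw [integral_rpow (Or.inl hr), hE, Real.zero_rpow (by positivity), sub_zero]
  have hV1 : ∫ s in v..t, (s - v) ^ (-(γ + δ)) = (t - v) ^ (3 * δ) / (3 * δ) := by
    rw [intervalIntegral.integral_comp_sub_right (fun x => x ^ (-(γ + δ))) v, sub_self, hbase]
  have hV2 : ∫ s in v..t, (t - s) ^ (-(γ + δ)) = (t - v) ^ (3 * δ) / (3 * δ) := by
    rw [intervalIntegral.integral_comp_sub_left (fun x => x ^ (-(γ + δ))) t, sub_self, hbase]
  have hα0 : 0 < α := by linarith
  set K := t ^ (α + δ) * α ^ (-δ) with hK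
  have hK0 : 0 ≤ K := by positivity
  set G : ℝ → ℝ := fun s => K * ((s - v) ^ (-(γ + δ)) + (t - s) ^ (-(γ + δ)))
  have hGI : IntervalIntegrable G volume v t := (hI1.add hI2).const_mul K
  have hGV : ∫ s in v..t, G s = K * (2 * ((t - v) ^ (3 * δ) / (3 * δ))) := by
    rw [intervalIntegral.integral_const_mul, intervalIntegral.integral_add hI1 hI2, hV1, hV2]
    ring
  calc ∫⁻ s in Ioc v t, ENNReal.ofReal (s ^ α / (s - v) ^ γ)
      = ∫⁻ s in Ioo v t, ENNReal.ofReal (s ^ α / (s - v) ^ γ) := by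
        rw [restrict_Ioo_eq_restrict_Ioc]
    _ ≤ ∫⁻ s in Ioo v t, ENNReal.ofReal (G s) := by
        refine setLIntegral_mono' measurableSet_Ioo fun s hs => ENNReal.ofReal_le_ofReal ?_
        have hsv : 0 < s - v := sub_pos.2 hs.1
        have hts : 0 < t - s := sub_pos.2 hs.2
        calc s ^ α / (s - v) ^ γ = s ^ α * (s - v) ^ (-γ) := by
              rw [Real.rpow_neg hsv.le, div_eq_mul_inv]
          _ ≤ (K * (t - s) ^ (-δ)) * (s - v) ^ (-γ) := by
              gcongr
              exact rpow_le_mul_sub_rpow_neg (hv.trans hs.1.le) hs.2 hα hδ0.le (by linarith)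
          _ = K * ((s - v) ^ (-γ) * (t - s) ^ (-δ)) := by ring
          _ ≤ G s := mul_le_mul_of_nonneg_left
              (rpow_neg_mul_rpow_neg_le_add hsv hts hγ.le hδ0.le) hK0
    _ = ENNReal.ofReal (∫ s in v..t, G s) := by
        rw [intervalIntegral.integral_of_le hvt, ← restrict_Ioo_eq_restrict_Ioc,
          ofReal_integral_eq_lintegral_ofReal]
        · rw [restrict_Ioo_eq_restrict_Ioc]
          exact hGI.1
        · refine (ae_restrict_mem measurableSet_Ioo).mono fun s hs => ?_
          have hsv : 0 < s - v := sub_pos.2 hs.1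
          have hts : 0 < t - s := sub_pos.2 hs.2
          simp only [Pi.zero_apply, G]
          positivity
    _ ≤ _ := by
        refine ENNReal.ofReal_le_ofReal ?_
        rw [hGV]
        have h1 : (t - v) ^ (3 * δ) ≤ t ^ (3 * δ) :=
          Real.rpow_le_rpow (by linarith) (by linarith) (by linarith)
        have h2 : t ^ (α + δ) * t ^ (3 * δ) ≤ t ^ (α + 2 * δ) := by
          rw [← Real.rpow_add ht0]
          exact Real.rpow_le_rpow_of_exponent_ge ht0 ht1 (by linarith)
        calc K * (2 * ((t - v) ^ (3 * δ) / (3 * δ)))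
            ≤ K * (2 * (t ^ (3 * δ) / (3 * δ))) := by gcongr
          _ = 2 / (3 * δ) * ((t ^ (α + δ) * t ^ (3 * δ)) * α ^ (-δ)) := by
            rw [hK]; ring
          _ ≤ _ := by gcongr

lemma lintegral_mul_ofReal_le_of_condExp_le {Ω : Type*} {m mΩ : MeasurableSpace Ω} {P : Measure Ω}
    [IsFiniteMeasure P] (hm : m ≤ mΩ) {f : Ω → ℝ} (hfm : Measurable f) (hf : Integrable f P)
    (hf0 : ∀ ω, 0 ≤ f ω) {k : ℝ} (hle : ∀ᵐ ω ∂P, (P[f | m]) ω ≤ k)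
    {Z : Ω → ENNReal} (hZ : Measurable[m] Z) :
    ∫⁻ ω, Z ω * ENNReal.ofReal (f ω) ∂P ≤ ENNReal.ofReal k * ∫⁻ ω, Z ω ∂P := by
  have htrim : (P.withDensity fun ω => ENNReal.ofReal (f ω)).trim hm ≤
      ENNReal.ofReal k • P.trim hm := by
    refine Measure.le_iff.2 fun E hE => ?_
    rw [trim_measurableSet_eq hm hE, withDensity_apply _ (hm E hE), Measure.smul_apply,
      trim_measurableSet_eq hm hE, smul_eq_mul,
      ← ofReal_integral_eq_lintegral_ofReal hf.restrict (ae_of_all _ hf0),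
      ← setIntegral_condExp hm hf hE, ← ENNReal.ofReal_toReal (measure_ne_top P E),
      ← ENNReal.ofReal_mul' ENNReal.toReal_nonneg]
    refine ENNReal.ofReal_le_ofReal ?_
    calc ∫ ω in E, (P[f | m]) ω ∂P ≤ ∫ _ in E, k ∂P :=
          integral_mono_ae integrable_condExp.restrict (integrable_const k) (ae_restrict_of_ae hle)
      _ = k * (P E).toReal := by simp [Measure.real, mul_comm]
  calc ∫⁻ ω, Z ω * ENNReal.ofReal (f ω) ∂P
      = ∫⁻ ω, Z ω ∂(P.withDensity fun ω => ENNReal.ofReal (f ω)) := by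
        rw [lintegral_withDensity_eq_lintegral_mul _ hfm.ennreal_ofReal (hZ.mono hm le_rfl)]
        simp only [Pi.mul_apply, mul_comm]
    _ = ∫⁻ ω, Z ω ∂((P.withDensity fun ω => ENNReal.ofReal (f ω)).trim hm) :=
        (lintegral_trim hm hZ).symm
    _ ≤ ∫⁻ ω, Z ω ∂(ENNReal.ofReal k • P.trim hm) := lintegral_mono' htrim le_rfl
    _ = _ := by rw [lintegral_smul_measure, lintegral_trim hm hZ, smul_eq_mul]

section Primitive

variable {g : ℝ → ℝ}

lemma integrableOn_of_mem_Icc (hg : Measurable g) (h01 : ∀ s, g s ∈ Icc (0 : ℝ) 1) {E : Set ℝ}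
    (hE : volume E ≠ ⊤) : IntegrableOn g E :=
  Measure.integrableOn_of_bounded (M := 1) hE hg.aestronglyMeasurable
    (ae_of_all _ fun s => by rw [Real.norm_of_nonneg (h01 s).1]; exact (h01 s).2)

lemma intervalIntegrable_of_mem_Icc (hg : Measurable g) (h01 : ∀ s, g s ∈ Icc (0 : ℝ) 1)
    (a b : ℝ) : IntervalIntegrable g volume a b :=
  ⟨integrableOn_of_mem_Icc hg h01 (by simp), integrableOn_of_mem_Icc hg h01 (by simp)⟩

lemma lipschitzWith_primitive (hg : Measurable g) (h01 : ∀ s, g s ∈ Icc (0 : ℝ) 1) :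
    LipschitzWith 1 fun v => ∫ s in (0 : ℝ)..v, g s := by
  refine LipschitzWith.of_dist_le_mul fun x y => ?_
  rw [Real.dist_eq, intervalIntegral.integral_interval_sub_left
    (intervalIntegrable_of_mem_Icc hg h01 _ _) (intervalIntegrable_of_mem_Icc hg h01 _ _),
    Real.dist_eq, NNReal.coe_one]
  exact intervalIntegral.norm_integral_le_of_norm_le_const fun s _ => by
    rw [Real.norm_of_nonneg (h01 s).1]; exact (h01 s).2

/-- Fundamental theorem of calculus along the primitive of a bounded measurable function. -/
lemma integral_deriv_comp_primitive_mul (hg : Measurable g) (h01 : ∀ s, g s ∈ Icc (0 : ℝ) 1)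
    {φ φ' : ℝ → ℝ} (hφ : ContDiff ℝ 1 φ) (hφ' : ∀ x, HasDerivAt φ (φ' x) x) (t : ℝ) :
    ∫ v in (0 : ℝ)..t, φ' (∫ s in (0 : ℝ)..v, g s) * g v =
      φ (∫ s in (0 : ℝ)..t, g s) - φ 0 := by
  set C : ℝ → ℝ := fun v => ∫ s in (0 : ℝ)..v, g s with hC
  have hC0 : C 0 = 0 := intervalIntegral.integral_same
  have hlip : LocallyLipschitz (φ ∘ C) :=
    hφ.locallyLipschitz.comp (lipschitzWith_primitive hg h01).locallyLipschitz
  obtain ⟨K, hK⟩ := (hlip.locallyLipschitzOn (s := uIcc 0 t)).exists_lipschitzOnWith_of_compact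
    isCompact_uIcc
  have hFTC := hK.absolutelyContinuousOnInterval.integral_deriv_eq_sub
  simp only [Function.comp_apply, hC0] at hFTC
  rw [← hFTC]
  have hloc : LocallyIntegrable g volume := fun x =>
    ⟨Icc (x - 1) (x + 1), Icc_mem_nhds (by linarith) (by linarith),
      integrableOn_of_mem_Icc hg h01 (by simp)⟩
  refine intervalIntegral.integral_congr_ae ?_
  filter_upwards [LocallyIntegrable.ae_hasDerivAt_integral hloc] with v hv _
  exact (((hφ' (C v)).comp v (hv 0)).deriv).symm

lemma integral_exp_primitive_mul (hg : Measurable g) (h01 : ∀ s, g s ∈ Icc (0 : ℝ) 1)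
    {θ : ℝ} (t : ℝ) :
    Real.exp (θ * ∫ s in (0 : ℝ)..t, g s) =
      1 + θ * ∫ v in (0 : ℝ)..t, Real.exp (θ * ∫ s in (0 : ℝ)..v, g s) * g v := by
  have h := integral_deriv_comp_primitive_mul hg h01 (φ := fun x => Real.exp (θ * x))
    (φ' := fun x => Real.exp (θ * x) * θ) (by fun_prop)
    (fun x => by simpa using ((hasDerivAt_id x).const_mul θ).exp) t
  simp only [mul_zero, Real.exp_zero] at h
  rw [← sub_eq_iff_eq_add', ← h, ← intervalIntegral.integral_const_mul θ (fun v => _ * g v)]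
  congr 1; ext v; ring

lemma integral_exp_primitive_mul_sub (hg : Measurable g) (h01 : ∀ s, g s ∈ Icc (0 : ℝ) 1)
    {θ : ℝ} (t : ℝ) :
    Real.exp (θ * ∫ s in (0 : ℝ)..t, g s) =
      1 + θ * (∫ s in (0 : ℝ)..t, g s) +
        θ * (θ * ∫ v in (0 : ℝ)..t, Real.exp (θ * ∫ s in (0 : ℝ)..v, g s) * g v *
          ∫ s in v..t, g s) := by
  set T := ∫ s in (0 : ℝ)..t, g s with hT
  have h := integral_deriv_comp_primitive_mul hg h01
    (φ := fun x => Real.exp (θ * x) * (1 + θ * (T - x)))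
    (φ' := fun x => θ * (θ * (Real.exp (θ * x) * (T - x)))) (by fun_prop)
    (fun x => by
      have h1 : HasDerivAt (fun x => Real.exp (θ * x)) (Real.exp (θ * x) * θ) x := by
        simpa using ((hasDerivAt_id x).const_mul θ).exp
      have h2 : HasDerivAt (fun x => 1 + θ * (T - x)) (-θ) x := by
        simpa using (((hasDerivAt_id x).const_sub T).const_mul θ).const_add 1
      exact (h1.mul h2).congr_deriv (by ring)) t
  simp only [← hT, mul_zero, Real.exp_zero, sub_self, add_zero, mul_one, sub_zero, one_mul] at h
  rw [← sub_eq_iff_eq_add', ← h, ← intervalIntegral.integral_const_mul θ (fun v => _ * _),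
    ← intervalIntegral.integral_const_mul]
  congr 1; ext v
  rw [hT, intervalIntegral.integral_interval_sub_left
    (intervalIntegrable_of_mem_Icc hg h01 _ _) (intervalIntegrable_of_mem_Icc hg h01 _ _)]
  ring

lemma ofReal_integral_eq_setLIntegral {h : ℝ → ℝ} {a b : ℝ} (hab : a ≤ b)
    (hi : IntervalIntegrable h volume a b) (h0 : ∀ s ∈ Ioc a b, 0 ≤ h s) :
    ENNReal.ofReal (∫ s in a..b, h s) = ∫⁻ s in Ioc a b, ENNReal.ofReal (h s) := by
  rw [intervalIntegral.integral_of_le hab, ofReal_integral_eq_lintegral_ofReal hi.1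
    ((ae_restrict_mem measurableSet_Ioc).mono h0)]

lemma ofReal_exp_primitive (hg : Measurable g) (h01 : ∀ s, g s ∈ Icc (0 : ℝ) 1)
    {θ t : ℝ} (hθ : 0 ≤ θ) (ht : 0 ≤ t) :
    ENNReal.ofReal (Real.exp (θ * ∫ s in (0 : ℝ)..t, g s)) =
      1 + ENNReal.ofReal θ * ∫⁻ v in Ioc 0 t,
        ENNReal.ofReal (Real.exp (θ * ∫ s in (0 : ℝ)..v, g s) * g v) := by
  have hc := (lipschitzWith_primitive hg h01).continuous
  have h0 : ∀ v, 0 ≤ Real.exp (θ * ∫ s in (0 : ℝ)..v, g s) * g v :=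
    fun v => mul_nonneg (Real.exp_pos _).le (h01 v).1
  have hi : IntervalIntegrable (fun v => Real.exp (θ * ∫ s in (0 : ℝ)..v, g s) * g v)
      volume 0 t :=
    (intervalIntegrable_of_mem_Icc hg h01 0 t).continuousOn_mul (by fun_prop)
  rw [integral_exp_primitive_mul hg h01, ENNReal.ofReal_add zero_le_one
    (mul_nonneg hθ (intervalIntegral.integral_nonneg ht fun v _ => h0 v)), ENNReal.ofReal_one,
    ENNReal.ofReal_mul hθ, ofReal_integral_eq_setLIntegral ht hi fun v _ => h0 v]

lemma ofReal_exp_primitive_sub (hg : Measurable g) (h01 : ∀ s, g s ∈ Icc (0 : ℝ) 1)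
    {θ t : ℝ} (hθ : 0 ≤ θ) (ht : 0 ≤ t) :
    ENNReal.ofReal (Real.exp (θ * ∫ s in (0 : ℝ)..t, g s)) =
      1 + ENNReal.ofReal θ * ENNReal.ofReal (∫ s in (0 : ℝ)..t, g s) +
        ENNReal.ofReal θ * (ENNReal.ofReal θ * ∫⁻ v in Ioc 0 t,
          ENNReal.ofReal (Real.exp (θ * ∫ s in (0 : ℝ)..v, g s) * g v) *
            ENNReal.ofReal (∫ s in v..t, g s)) := by
  have hc := (lipschitzWith_primitive hg h01).continuous
  have h0 : ∀ v, 0 ≤ Real.exp (θ * ∫ s in (0 : ℝ)..v, g s) * g v :=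
    fun v => mul_nonneg (Real.exp_pos _).le (h01 v).1
  have hD : ∀ v ≤ t, 0 ≤ ∫ s in v..t, g s := fun v hv =>
    intervalIntegral.integral_nonneg hv fun s _ => (h01 s).1
  have hDc : Continuous fun v => ∫ s in v..t, g s := by
    have : (fun v => ∫ s in v..t, g s) =
        fun v => (∫ s in (0 : ℝ)..t, g s) - ∫ s in (0 : ℝ)..v, g s := by
      ext v
      rw [intervalIntegral.integral_interval_sub_left
        (intervalIntegrable_of_mem_Icc hg h01 _ _) (intervalIntegrable_of_mem_Icc hg h01 _ _)]
    rw [this]; fun_prop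
  have hi : IntervalIntegrable (fun v => Real.exp (θ * ∫ s in (0 : ℝ)..v, g s) * g v *
      ∫ s in v..t, g s) volume 0 t :=
    ((intervalIntegrable_of_mem_Icc hg h01 0 t).continuousOn_mul (by fun_prop)).mul_continuousOn
      hDc.continuousOn
  have hi0 : 0 ≤ ∫ v in (0 : ℝ)..t, Real.exp (θ * ∫ s in (0 : ℝ)..v, g s) * g v *
      ∫ s in v..t, g s :=
    intervalIntegral.integral_nonneg ht fun v hv => mul_nonneg (h0 v) (hD v hv.2)
  rw [integral_exp_primitive_mul_sub hg h01,
    ENNReal.ofReal_add (add_nonneg zero_le_one (mul_nonneg hθ (hD 0 ht))) (by positivity),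
    ENNReal.ofReal_add zero_le_one (mul_nonneg hθ (hD 0 ht)), ENNReal.ofReal_one,
    ENNReal.ofReal_mul hθ, ENNReal.ofReal_mul hθ, ENNReal.ofReal_mul hθ,
    ofReal_integral_eq_setLIntegral ht hi fun v hv => mul_nonneg (h0 v) (hD v hv.2)]
  simp only [ENNReal.ofReal_mul (h0 _)]

end Primitive

lemma Measurable.uncurry_swap {α β γ : Type*} [MeasurableSpace α] [MeasurableSpace β]
    [MeasurableSpace γ] {f : α → β → γ} (hf : Measurable (Function.uncurry f)) :
    Measurable (Function.uncurry fun b a => f a b) :=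
  hf.comp measurable_swap

lemma measurable_intervalIntegral_of_uncurry {Ω : Type*} {m : MeasurableSpace Ω}
    {g : ℝ → Ω → ℝ} (hg : Measurable (Function.uncurry g)) (a b : ℝ) :
    Measurable fun ω => ∫ s in a..b, g s ω := by
  have h : ∀ μ : Measure ℝ, SFinite μ → Measurable fun ω => ∫ s, g s ω ∂μ := fun μ _ =>
    (hg.stronglyMeasurable.integral_prod_left' (μ := μ)).measurable
  exact (h _ inferInstance).sub (h _ inferInstance)

lemma ENNReal.le_two_of_le_one_add_half {x : ENNReal} (hx : x ≠ ⊤) (h : x ≤ 1 + 2⁻¹ * x) :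
    x ≤ 2 := by
  lift x to NNReal using hx
  have h2 : (2⁻¹ : ENNReal) = ((2⁻¹ : NNReal) : ENNReal) := by simp
  rw [h2] at h
  have h3 : x ≤ 1 + 2⁻¹ * x := by exact_mod_cast h
  have h4 : (x : ℝ) ≤ 1 + 2⁻¹ * x := by exact_mod_cast h3
  have h5 : x ≤ 2 := by
    have : (x : ℝ) ≤ 2 := by linarith
    exact_mod_cast this
  exact_mod_cast h5

/-- **Khasminskii's lemma**: if the expected remaining occupation is at most `M` given the past,
then the total occupation has an exponential moment. -/
lemma lintegral_exp_primitive_le_two {Ω : Type*} {mΩ : MeasurableSpace Ω} {P : Measure Ω}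
    [IsProbabilityMeasure P] {ℱ : Filtration ℝ mΩ} {g : ℝ → Ω → ℝ}
    (hg : Measurable (Function.uncurry g)) (h01 : ∀ s ω, g s ω ∈ Icc (0 : ℝ) 1) {t M : ℝ}
    (ht : 0 ≤ t) (hM : 0 < M) (hgad : ∀ v, 0 ≤ v → Measurable[ℱ v] (g v))
    (hCad : ∀ v, 0 ≤ v → Measurable[ℱ v] fun ω => ∫ s in (0 : ℝ)..v, g s ω)
    (hbound : ∀ v, 0 ≤ v → v ≤ t → ∀ Z : Ω → ENNReal, Measurable[ℱ v] Z →
      ∫⁻ ω, Z ω * ENNReal.ofReal (∫ s in v..t, g s ω) ∂P ≤ ENNReal.ofReal M * ∫⁻ ω, Z ω ∂P) :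
    ∫⁻ ω, ENNReal.ofReal (Real.exp ((2 * M)⁻¹ * ∫ s in (0 : ℝ)..t, g s ω)) ∂P ≤ 2 := by
  set θ : ℝ := (2 * M)⁻¹ with hθdef
  have hθ : 0 ≤ θ := by positivity
  have hgω : ∀ ω, Measurable fun s => g s ω := fun ω => hg.comp measurable_prodMk_right
  set C : ℝ → Ω → ℝ := fun v ω => ∫ s in (0 : ℝ)..v, g s ω with hC
  have hCcont : ∀ ω, Continuous fun v => C v ω := fun ω =>
    (lipschitzWith_primitive (hgω ω) fun s => h01 s ω).continuous
  have hCmeas : ∀ v, Measurable (C v) := fun v => measurable_intervalIntegral_of_uncurry hg 0 v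
  have hCjoint : Measurable (Function.uncurry C) :=
    measurable_uncurry_of_continuous_of_measurable hCcont hCmeas
  have hsub : ∀ v ω, ∫ s in v..t, g s ω = C t ω - C v ω := fun v ω => by
    rw [hC, intervalIntegral.integral_interval_sub_left
      (intervalIntegrable_of_mem_Icc (hgω ω) (h01 · ω) _ _)
      (intervalIntegrable_of_mem_Icc (hgω ω) (h01 · ω) _ _)]
  set Z : ℝ → Ω → ENNReal := fun v ω => ENNReal.ofReal (Real.exp (θ * C v ω) * g v ω) with hZ
  have hZjoint : Measurable (Function.uncurry Z) :=
    ((hCjoint.const_mul θ).exp.mul hg).ennreal_ofReal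
  have hZad : ∀ v, 0 ≤ v → Measurable[ℱ v] (Z v) := fun v hv =>
    (((hCad v hv).const_mul θ).exp.mul (hgad v hv)).ennreal_ofReal
  have hDjoint : Measurable (Function.uncurry fun v ω => ENNReal.ofReal (∫ s in v..t, g s ω)) := by
    simp only [hsub]
    exact (((hCmeas t).comp measurable_snd).sub hCjoint).ennreal_ofReal
  set E := ∫⁻ ω, ENNReal.ofReal (Real.exp (θ * C t ω)) ∂P with hE
  set J := ∫⁻ ω, ∫⁻ v in Ioc 0 t, Z v ω ∂volume ∂P with hJ
  have hswapZ : Measurable (Function.uncurry fun ω v => Z v ω) := hZjoint.uncurry_swap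
  have hswapZD : Measurable (Function.uncurry fun ω v =>
      Z v ω * ENNReal.ofReal (∫ s in v..t, g s ω)) :=
    Measurable.uncurry_swap (hZjoint.mul hDjoint)
  have hE1 : E = 1 + ENNReal.ofReal θ * J := by
    rw [hE, lintegral_congr fun ω => ofReal_exp_primitive (hgω ω) (h01 · ω) hθ ht,
      lintegral_add_left measurable_const, lintegral_const_mul _ hswapZ.lintegral_prod_right]
    simp [hJ, hZ, hC]
  have hfirst : ∫⁻ ω, ENNReal.ofReal (C t ω) ∂P ≤ ENNReal.ofReal M := by
    simpa using hbound 0 le_rfl ht (fun _ => 1) measurable_const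
  have hsecond : ∫⁻ ω, ∫⁻ v in Ioc 0 t, Z v ω * ENNReal.ofReal (∫ s in v..t, g s ω) ∂volume ∂P ≤
      ENNReal.ofReal M * J := by
    rw [lintegral_lintegral_swap hswapZD.aemeasurable, hJ,
      lintegral_lintegral_swap hswapZ.aemeasurable,
      ← lintegral_const_mul _ hZjoint.lintegral_prod_right]
    exact setLIntegral_mono' measurableSet_Ioc fun v hv =>
      hbound v hv.1.le hv.2 (Z v) (hZad v hv.1.le)
  have hE2 : E ≤ 1 + ENNReal.ofReal θ * ENNReal.ofReal M * E := by
    calc E = 1 + ENNReal.ofReal θ * ∫⁻ ω, ENNReal.ofReal (C t ω) ∂P +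
          ENNReal.ofReal θ * (ENNReal.ofReal θ *
            ∫⁻ ω, ∫⁻ v in Ioc 0 t, Z v ω * ENNReal.ofReal (∫ s in v..t, g s ω) ∂volume ∂P) := by
          have hm1 : Measurable fun ω => ENNReal.ofReal (C t ω) := (hCmeas t).ennreal_ofReal
          have hm2 := hswapZD.lintegral_prod_right (ν := volume.restrict (Ioc 0 t))
          have hlin : ∀ {X Y : Ω → ENNReal} (a : ENNReal), Measurable X → Measurable Y →
              ∫⁻ ω, (1 + a * X ω + a * (a * Y ω)) ∂P =
                1 + a * ∫⁻ ω, X ω ∂P + a * (a * ∫⁻ ω, Y ω ∂P) := fun a hX hY => by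
            rw [lintegral_add_left (by fun_prop), lintegral_add_left measurable_const,
              lintegral_const_mul _ hX, lintegral_const_mul _ (hY.const_mul _),
              lintegral_const_mul _ hY]
            simp
          exact (lintegral_congr fun ω => ofReal_exp_primitive_sub (hgω ω) (h01 · ω) hθ ht).trans
            (hlin _ hm1 hm2)
      _ ≤ 1 + ENNReal.ofReal θ * ENNReal.ofReal M +
          ENNReal.ofReal θ * (ENNReal.ofReal θ * (ENNReal.ofReal M * J)) := by gcongr
      _ = _ := by rw [hE1]; ring
  have hθM : ENNReal.ofReal θ * ENNReal.ofReal M = 2⁻¹ := by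
    rw [← ENNReal.ofReal_mul hθ, hθdef, mul_inv, mul_assoc, inv_mul_cancel₀ hM.ne', mul_one,
      ENNReal.ofReal_inv_of_pos two_pos, ENNReal.ofReal_ofNat]
  have hfin : E ≠ ⊤ := by
    have hle : E ≤ ENNReal.ofReal (Real.exp (θ * t)) := by
      calc E ≤ ∫⁻ _, ENNReal.ofReal (Real.exp (θ * t)) ∂P := by
            refine lintegral_mono fun ω => ENNReal.ofReal_le_ofReal (Real.exp_le_exp.2 ?_)
            have h := (lipschitzWith_primitive (hgω ω) (h01 · ω)).dist_le_mul t 0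
            simp only [intervalIntegral.integral_same, dist_zero_right, NNReal.coe_one, one_mul,
              Real.norm_eq_abs, abs_of_nonneg ht] at h
            exact mul_le_mul_of_nonneg_left ((le_abs_self _).trans h) hθ
        _ = _ := by simp
    exact ne_top_of_le_ne_top ENNReal.ofReal_ne_top hle
  rw [hθM] at hE2
  exact ENNReal.le_two_of_le_one_add_half hfin hE2

lemma measurable_indicator_Ioo_rpow {Ω : Type*} {m : MeasurableSpace Ω} {Y : ℝ → Ω → ℝ}
    (hY : Measurable (Function.uncurry Y)) (A α : ℝ) :
    Measurable (Function.uncurry fun s ω =>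
      (Ioo 0 (A * s ^ α)).indicator (fun _ => (1 : ℝ)) (Y s ω)) := by
  have hU : MeasurableSet {p : ℝ × Ω | 0 < Function.uncurry Y p ∧
      Function.uncurry Y p < A * p.1 ^ α} :=
    (measurableSet_lt measurable_const hY).inter
      (measurableSet_lt hY ((measurable_fst.pow_const α).const_mul A))
  exact measurable_const.indicator hU

lemma toReal_volume_occupation {b : ℝ → ℝ} {A α t : ℝ} (ht : 0 ≤ t)
    (hg : Measurable fun s => (Ioo 0 (A * s ^ α)).indicator (fun _ => (1 : ℝ)) (b s)) :
    (volume {s ∈ Ioc (0 : ℝ) t | 0 < b s ∧ b s < A * s ^ α}).toReal =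
      ∫ s in (0 : ℝ)..t, (Ioo 0 (A * s ^ α)).indicator (fun _ => (1 : ℝ)) (b s) := by
  set U := {s : ℝ | 0 < b s ∧ b s < A * s ^ α} with hUdef
  have hind : (fun s => (Ioo 0 (A * s ^ α)).indicator (fun _ => (1 : ℝ)) (b s)) =
      U.indicator fun _ => (1 : ℝ) := rfl
  have hU : MeasurableSet U := (measurable_indicator_const_iff (1 : ℝ)).1 (hind ▸ hg)
  rw [hind, intervalIntegral.integral_of_le ht, integral_indicator_const _ hU, smul_eq_mul,
    mul_one, Measure.real, Measure.restrict_apply hU, inter_comm]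
  rfl

/-- Lemma 2.14: if the continuous adapted process `B` has conditional densities bounded
by `c (t-s)^{-γ}`, `δ = (1-γ)/4`, and `C_t = ∫_0^t 1_{(0 < B_s < A s^α)} ds`, then
`P(C_t > λ) ≤ c1 exp(-c2 λ α^δ / (A t^{α+2δ}))` for constants `c1, c2` independent
of `α` and `A`. -/
theorem occupation_time_exponential_bound
    {Ω : Type*} [mΩ : MeasurableSpace Ω] (P : Measure Ω) [IsProbabilityMeasure P]
    (ℱ : Filtration ℝ mΩ) (B : ℝ → Ω → ℝ)
    (hBadapted : Adapted ℱ B) (hBcont : ∀ ω, Continuous fun t => B t ω)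
    (c γ : ℝ) (hc : 0 < c) (hγ : γ ∈ Ioo (0:ℝ) 1)
    (hdens : ∀ s t : ℝ, 0 ≤ s → s < t →
      ∀ A : Set ℝ, MeasurableSet A → volume A < ⊤ →
      ∀ᵐ ω ∂P, (P[(fun ω => A.indicator (fun _ => (1:ℝ)) (B t ω)) | ℱ s]) ω ≤
        c / (t - s) ^ γ * (volume A).toReal)
    (δ : ℝ) (hδ : δ = (1 - γ) / 4)
    (t : ℝ) (ht0 : 0 < t) (ht1 : t ≤ 1) :
    ∃ c1 c2 : ℝ, 0 < c1 ∧ 0 < c2 ∧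
      ∀ α : ℝ, 1 ≤ α → ∀ A : ℝ, 0 < A → ∀ lam : ℝ, 0 < lam →
        P {ω | lam <
            (volume {s ∈ Ioc (0:ℝ) t | 0 < B s ω ∧ B s ω < A * s ^ α}).toReal} ≤
          ENNReal.ofReal
            (c1 * Real.exp (-(c2 * lam * α ^ δ / (A * t ^ (α + 2 * δ))))) := by
  have hδ0 : 0 < δ := by linarith [hγ.2]
  have hγδ : γ + 4 * δ = 1 := by linarith
  refine ⟨2, 3 * δ / (4 * c), two_pos, by positivity, fun α hα A hA lam hlam => ?_⟩
  have hα0 : 0 < α := by linarith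
  set g : ℝ → Ω → ℝ := fun s ω =>
    (Ioo 0 (A * s ^ α)).indicator (fun _ => (1 : ℝ)) (B s ω) with hgdef
  have h01 : ∀ s ω, g s ω ∈ Icc (0 : ℝ) 1 := fun s ω =>
    ⟨indicator_nonneg (fun _ _ => zero_le_one) _,
      indicator_le_self' (fun _ _ => zero_le_one) _⟩
  have hB : Measurable (Function.uncurry B) :=
    measurable_uncurry_of_continuous_of_measurable hBcont fun s =>
      (hBadapted s).mono (ℱ.le s) le_rfl
  have hg : Measurable (Function.uncurry g) := measurable_indicator_Ioo_rpow hB A α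
  have hgs : ∀ s, Measurable (g s) := fun s => hg.comp measurable_prodMk_left
  have hgω : ∀ ω, Measurable fun s => g s ω := fun ω => hg.comp measurable_prodMk_right
  have hgad : ∀ v, 0 ≤ v → Measurable[ℱ v] (g v) := fun v _ =>
    (measurable_const.indicator measurableSet_Ioo).comp (hBadapted v)
  have hCad : ∀ v, 0 ≤ v → Measurable[ℱ v] fun ω => ∫ s in (0 : ℝ)..v, g s ω := by
    intro v hv
    have hmin := measurable_intervalIntegral_of_uncurry (measurable_indicator_Ioo_rpow
      (measurable_uncurry_of_continuous_of_measurable (m := ℱ v) (u := fun s ω => B (min s v) ω)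
        (fun ω => (hBcont ω).comp (continuous_id.min continuous_const))
        fun s => (hBadapted _).mono (ℱ.mono (min_le_right s v)) le_rfl) A α) 0 v
    convert hmin using 2 with ω
    refine intervalIntegral.integral_congr fun s hs => ?_
    rw [uIcc_of_le hv] at hs
    simp only [hgdef, min_eq_left hs.2]
  set M := c * A * (2 / (3 * δ) * (t ^ (α + 2 * δ) * α ^ (-δ))) with hMdef
  have hM : 0 < M := by positivity
  have hbound : ∀ v, 0 ≤ v → v ≤ t → ∀ Z : Ω → ENNReal, Measurable[ℱ v] Z →
      ∫⁻ ω, Z ω * ENNReal.ofReal (∫ s in v..t, g s ω) ∂P ≤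
        ENNReal.ofReal M * ∫⁻ ω, Z ω ∂P := by
    intro v hv hvt Z hZ
    have hZ' : Measurable Z := hZ.mono (ℱ.le v) le_rfl
    calc ∫⁻ ω, Z ω * ENNReal.ofReal (∫ s in v..t, g s ω) ∂P
        = ∫⁻ ω, ∫⁻ s in Ioc v t, Z ω * ENNReal.ofReal (g s ω) ∂volume ∂P := by
          refine lintegral_congr fun ω => ?_
          rw [ofReal_integral_eq_setLIntegral hvt
            (intervalIntegrable_of_mem_Icc (hgω ω) (h01 · ω) v t) fun s _ => (h01 s ω).1,
            lintegral_const_mul _ (hgω ω).ennreal_ofReal]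
      _ = ∫⁻ s in Ioc v t, ∫⁻ ω, Z ω * ENNReal.ofReal (g s ω) ∂P := by
          refine lintegral_lintegral_swap (Measurable.aemeasurable ?_)
          exact (hZ'.comp measurable_fst).mul (Measurable.uncurry_swap hg).ennreal_ofReal
      _ ≤ ∫⁻ s in Ioc v t, ENNReal.ofReal (c * A) * ENNReal.ofReal (s ^ α / (s - v) ^ γ) *
            ∫⁻ ω, Z ω ∂P := by
          refine setLIntegral_mono' measurableSet_Ioc fun s hs => ?_
          have hs0 : 0 ≤ s := hv.trans hs.1.le
          have hd := hdens v s hv hs.1 (Ioo 0 (A * s ^ α)) measurableSet_Ioo (by simp)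
          rw [← ENNReal.ofReal_mul (by positivity)]
          refine lintegral_mul_ofReal_le_of_condExp_le (ℱ.le v) (hgs s) ?_
            (fun ω => (h01 s ω).1) ?_ hZ
          · exact Integrable.of_bound (hgs s).aestronglyMeasurable 1
              (ae_of_all _ fun ω => by rw [Real.norm_of_nonneg (h01 s ω).1]; exact (h01 s ω).2)
          · filter_upwards [hd] with ω hω
            refine hω.trans_eq ?_
            rw [Real.volume_Ioo, sub_zero, ENNReal.toReal_ofReal (by positivity)]
            ring
      _ = ENNReal.ofReal (c * A) * (∫⁻ s in Ioc v t, ENNReal.ofReal (s ^ α / (s - v) ^ γ)) *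
            ∫⁻ ω, Z ω ∂P := by
          have hk : Measurable fun s : ℝ => ENNReal.ofReal (s ^ α / (s - v) ^ γ) := by fun_prop
          rw [lintegral_mul_const _ (hk.const_mul _), lintegral_const_mul _ hk]
      _ ≤ ENNReal.ofReal M * ∫⁻ ω, Z ω ∂P := by
          rw [hMdef, ENNReal.ofReal_mul (by positivity : 0 ≤ c * A)]
          gcongr
          exact lintegral_rpow_div_sub_rpow_le hv hvt ht0 ht1 hα hγ.1 hδ0 hγδ
  have hexp := lintegral_exp_primitive_le_two hg h01 ht0.le hM hgad hCad hbound
  have hrate : 3 * δ / (4 * c) * lam * α ^ δ / (A * t ^ (α + 2 * δ)) = (2 * M)⁻¹ * lam := by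
    rw [hMdef, Real.rpow_neg hα0.le]
    field_simp
    norm_num
  rw [hrate]
  set X : Ω → ℝ := fun ω => Real.exp ((2 * M)⁻¹ * ∫ s in (0 : ℝ)..t, g s ω) with hX
  have hXm : Measurable X :=
    ((measurable_intervalIntegral_of_uncurry hg 0 t).const_mul _).exp
  have hmarkov := mul_meas_ge_le_lintegral (μ := P) hXm.ennreal_ofReal
    (ENNReal.ofReal (Real.exp ((2 * M)⁻¹ * lam)))
  have hsubset : {ω | lam <
      (volume {s ∈ Ioc (0:ℝ) t | 0 < B s ω ∧ B s ω < A * s ^ α}).toReal} ⊆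
      {ω | ENNReal.ofReal (Real.exp ((2 * M)⁻¹ * lam)) ≤ ENNReal.ofReal (X ω)} := by
    intro ω hω
    rw [mem_ofPred_eq, toReal_volume_occupation ht0.le (hgω ω)] at hω
    refine ENNReal.ofReal_le_ofReal (Real.exp_le_exp.2 ?_)
    exact mul_le_mul_of_nonneg_left hω.le (by positivity)
  refine (measure_mono hsubset).trans ?_
  rw [Real.exp_neg, ← div_eq_mul_inv, ENNReal.ofReal_div_of_pos (Real.exp_pos _),
    ENNReal.le_div_iff_mul_le (by simp [Real.exp_pos]) (by simp), mul_comm, ENNReal.ofReal_ofNat]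
  exact hmarkov.trans hexp
end

section
/- Let B_t be a continuous adapted process satisfying: there exist c > 0 and γ ∈ (0,1) such that P(B_t ∈ dy | F_s) ≤ c (t − s)^{−γ} dy for all y ∈ ℝ whenever s < t. Set δ = (1 − γ)/4 and C_t = ∫_0^t 1_{(0 < B_s < A s^α)} ds. Given ξ > 0, there exist constants c1, c2 > 0 such that whenever α ≥ 1, A, B > 0 with B/A > ξ, and β = α + δ, one has P(C_t ≥ B t^β for some t ≤ 1/2) ≤ c1 exp(−c2 B α^δ / A). -/
open MeasureTheory ProbabilityTheory Filter Set
open scoped ENNReal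

/-- Iterated-integral formula: `μ (s, ∞) ^ (n + 1) = (n + 1) ∫_{r > s} μ (r, ∞) ^ n dμ(r)`. -/
theorem pow_measure_Ioi_eq_lintegral (μ : Measure ℝ) [SFinite μ] [NullSingletonClass μ]
    (n : ℕ) (s : ℝ) :
    μ (Ioi s) ^ (n + 1) = (n + 1 : ℕ) * ∫⁻ r in Ioi s, μ (Ioi r) ^ n ∂μ := by
  have hf : Measurable fun r => μ (Ioi r) :=
    Antitone.measurable fun a b h => measure_mono (Ioi_subset_Ioi h)
  induction n generalizing s with
  | zero => simp
  | succ n ih =>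
    have hfn : Measurable fun r => μ (Ioi r) ^ n := hf.pow_const n
    have hsplit : ∀ r ∈ Ioi s, μ (Ioi s) = μ (Ioi r) + μ (Ioc s r) := by
      intro r hr
      rw [← Ioc_union_Ioi_eq_Ioi (le_of_lt hr), measure_union _ measurableSet_Ioi, add_comm]
      exact Set.disjoint_left.2 fun u hu hu' => absurd hu.2 (not_le.2 hu')
    have hswap : ∫⁻ r in Ioi s, μ (Ioc s r) * μ (Ioi r) ^ n ∂μ
        = ∫⁻ u in Ioi s, ∫⁻ r in Ioi u, μ (Ioi r) ^ n ∂μ ∂μ := by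
      have h1 : ∀ r, μ (Ioc s r) * μ (Ioi r) ^ n
          = ∫⁻ u in Ioi s, (Iic r).indicator (fun _ => μ (Ioi r) ^ n) u ∂μ := by
        intro r
        rw [lintegral_indicator measurableSet_Iic, setLIntegral_const,
          Measure.restrict_apply measurableSet_Iic, inter_comm, Ioi_inter_Iic, mul_comm]
      have h2 : ∀ u ∈ Ioi s, ∫⁻ r in Ioi u, μ (Ioi r) ^ n ∂μ
          = ∫⁻ r in Ioi s, (Ici u).indicator (fun r => μ (Ioi r) ^ n) r ∂μ := by
        intro u hu
        rw [lintegral_indicator measurableSet_Ici, Measure.restrict_restrict measurableSet_Ici,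
          inter_eq_left.2 (Ici_subset_Ioi.2 hu)]
        exact setLIntegral_congr Ioi_ae_eq_Ici
      rw [setLIntegral_congr_fun measurableSet_Ioi h2]
      simp_rw [h1]
      rw [lintegral_lintegral_swap]
      · refine lintegral_congr fun u => lintegral_congr fun r => ?_
        simp only [indicator, mem_Iic, mem_Ici]
      · have : (Function.uncurry fun r u => (Iic r).indicator (fun _ => μ (Ioi r) ^ n) u)
            = {p : ℝ × ℝ | p.2 ≤ p.1}.indicator (fun p => μ (Ioi p.1) ^ n) := by
          ext p; rfl
        rw [this]
        exact ((hfn.comp measurable_fst).indicator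
          (measurableSet_le measurable_snd measurable_fst)).aemeasurable
    calc μ (Ioi s) ^ (n + 1 + 1) = μ (Ioi s) * μ (Ioi s) ^ (n + 1) := pow_succ' _ _
      _ = (n + 1 : ℕ) * ∫⁻ r in Ioi s, μ (Ioi s) * μ (Ioi r) ^ n ∂μ := by
        rw [ih s, lintegral_const_mul _ hfn]; ring
      _ = (n + 1 : ℕ) * ∫⁻ r in Ioi s, (μ (Ioi r) ^ (n + 1) + μ (Ioc s r) * μ (Ioi r) ^ n) ∂μ := by
        congr 1
        refine setLIntegral_congr_fun measurableSet_Ioi fun r hr => ?_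
        rw [pow_succ', ← add_mul, hsplit r hr]
      _ = (n + 1 : ℕ) * ∫⁻ r in Ioi s, μ (Ioi r) ^ (n + 1) ∂μ
          + ∫⁻ u in Ioi s, (n + 1 : ℕ) * ∫⁻ r in Ioi u, μ (Ioi r) ^ n ∂μ ∂μ := by
        rw [lintegral_add_left (hf.pow_const _), hswap, mul_add,
          lintegral_const_mul' _ _ (ENNReal.natCast_ne_top _)]
      _ = (n + 1 + 1 : ℕ) * ∫⁻ r in Ioi s, μ (Ioi r) ^ (n + 1) ∂μ := by
        simp_rw [← ih]
        push_cast
        ring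

section

variable {Ω : Type*} [mΩ : MeasurableSpace Ω]

theorem measurable_volume_section_Ioi {D : Set (ℝ × Ω)} (hD : MeasurableSet D) :
    Measurable fun p : ℝ × Ω => volume ({r | (r, p.2) ∈ D} ∩ Ioi p.1) := by
  have h : MeasurableSet {q : (ℝ × Ω) × ℝ | (q.2, q.1.2) ∈ D ∧ q.1.1 < q.2} :=
    (measurableSet_preimage (by fun_prop : Measurable fun q : (ℝ × Ω) × ℝ => (q.2, q.1.2)) hD).inter
      (measurableSet_lt (measurable_fst.comp measurable_fst) measurable_snd)
  exact measurable_measure_prodMk_left h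

/-- **Khasminskii's moment bound** for the time spent after `s` in a random set whose conditional
probabilities at fixed times are bounded by a kernel of mass at most `M`. -/
theorem setLIntegral_volume_section_pow_le (P : Measure Ω) [IsFiniteMeasure P]
    (ℱ : Filtration ℝ mΩ) {D : Set (ℝ × Ω)} (hD : MeasurableSet D) {T : ℝ}
    (hDT : ∀ r ω, (r, ω) ∈ D → r ≤ T)
    (hDF : ∀ r, MeasurableSet[ℱ r] {ω | (r, ω) ∈ D}) (k : ℝ → ℝ → ℝ≥0∞) (M : ℝ≥0∞)
    (hk : ∀ s r, 0 ≤ s → s < r → r ≤ T → ∀ G, MeasurableSet[ℱ s] G →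
      P (G ∩ {ω | (r, ω) ∈ D}) ≤ k s r * P G)
    (hM : ∀ s, 0 ≤ s → ∫⁻ r in Ioc s T, k s r ≤ M) (hMt : M ≠ ∞)
    (n : ℕ) (s : ℝ) (hs : 0 ≤ s) (G : Set Ω) (hG : MeasurableSet[ℱ s] G) :
    ∫⁻ ω in G, volume ({r | (r, ω) ∈ D} ∩ Ioi s) ^ n ∂P ≤ n.factorial * M ^ n * P G := by
  induction n generalizing s G with
  | zero => simp
  | succ n ih =>
    have hmeas := measurable_volume_section_Ioi hD
    have hsec : ∀ ω, MeasurableSet {r | (r, ω) ∈ D} := fun ω =>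
      measurableSet_preimage (by fun_prop : Measurable fun r : ℝ => (r, ω)) hD
    have key : ∀ ω, volume ({r | (r, ω) ∈ D} ∩ Ioi s) ^ (n + 1) = (n + 1 : ℕ) *
        ∫⁻ r in Ioc s T, D.indicator
          (fun p => volume ({r | (r, p.2) ∈ D} ∩ Ioi p.1) ^ n) (r, ω) := by
      intro ω
      have h := pow_measure_Ioi_eq_lintegral (volume.restrict {r | (r, ω) ∈ D}) n s
      simp only [Measure.restrict_apply measurableSet_Ioi, inter_comm (Ioi _)] at h
      rw [h, Measure.restrict_restrict measurableSet_Ioi]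
      congr 1
      have : Ioi s ∩ {r | (r, ω) ∈ D} = Ioc s T ∩ {r | (r, ω) ∈ D} := by
        ext r
        simp only [mem_inter_iff, mem_Ioi, mem_Ioc, mem_ofPred_eq]
        exact ⟨fun h => ⟨⟨h.1, hDT _ _ h.2⟩, h.2⟩, fun h => ⟨h.1.1, h.2⟩⟩
      rw [this, inter_comm, ← Measure.restrict_restrict (hsec ω), ← lintegral_indicator (hsec ω)]
      rfl
    have hind : Measurable
        (D.indicator fun p : ℝ × Ω => volume ({r | (r, p.2) ∈ D} ∩ Ioi p.1) ^ n) :=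
      (hmeas.pow_const n).indicator hD
    simp_rw [key]
    rw [lintegral_const_mul' _ _ (ENNReal.natCast_ne_top _), lintegral_lintegral_swap
      (f := fun ω r => D.indicator
        (fun p : ℝ × Ω => volume ({r | (r, p.2) ∈ D} ∩ Ioi p.1) ^ n) (r, ω))
      (hind.comp measurable_swap).aemeasurable]
    have hstep : ∀ r ∈ Ioc s T, ∫⁻ ω in G, D.indicator
          (fun p : ℝ × Ω => volume ({r | (r, p.2) ∈ D} ∩ Ioi p.1) ^ n) (r, ω) ∂P
        ≤ (n.factorial * M ^ n * P G) * k s r := by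
      intro r hr
      have hDr := ℱ.le r _ (hDF r)
      have hGr : MeasurableSet[ℱ r] (G ∩ {ω | (r, ω) ∈ D}) :=
        MeasurableSet.inter (ℱ.mono hr.1.le _ hG) (hDF r)
      calc _ = ∫⁻ ω in G ∩ {ω | (r, ω) ∈ D}, volume ({r | (r, ω) ∈ D} ∩ Ioi r) ^ n ∂P := by
            rw [inter_comm, ← Measure.restrict_restrict hDr, ← lintegral_indicator hDr]
            rfl
        _ ≤ n.factorial * M ^ n * P (G ∩ {ω | (r, ω) ∈ D}) := ih r (hs.trans hr.1.le) _ hGr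
        _ ≤ n.factorial * M ^ n * (k s r * P G) := by
            gcongr
            exact hk s r hs hr.1 hr.2 G hG
        _ = _ := by ring
    calc _ ≤ (n + 1 : ℕ) * ∫⁻ r in Ioc s T, (n.factorial * M ^ n * P G) * k s r := by
          exact mul_le_mul_right (setLIntegral_mono' measurableSet_Ioc hstep) _
      _ ≤ (n + 1 : ℕ) * ((n.factorial * M ^ n * P G) * M) := by
          rw [lintegral_const_mul' _ _ ?_]
          · gcongr
            exact hM s hs
          · exact ENNReal.mul_ne_top (ENNReal.mul_ne_top (ENNReal.natCast_ne_top _)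
              (ENNReal.pow_ne_top hMt)) (measure_ne_top P G)
      _ = _ := by
          rw [Nat.factorial_succ]; push_cast; ring

/-- Moments bounded by `n! M ^ n` give an exponential tail of rate `1 / (2 M)`. -/
theorem measure_le_of_moments_le (P : Measure Ω) [IsProbabilityMeasure P]
    {X : Ω → ℝ} (hX : Measurable X) (hX0 : ∀ ω, 0 ≤ X ω) {M : ℝ} (hM : 0 < M)
    (hmom : ∀ n : ℕ, ∫⁻ ω, ENNReal.ofReal (X ω) ^ n ∂P ≤ n.factorial * ENNReal.ofReal M ^ n)
    (a : ℝ) :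
    P {ω | a ≤ X ω} ≤ ENNReal.ofReal (2 * Real.exp (-(a / (2 * M)))) := by
  have hexp : ∀ ω, ENNReal.ofReal (Real.exp (X ω / (2 * M)))
      = ∑' n : ℕ, ENNReal.ofReal ((2 * M)⁻¹ ^ n / n.factorial) * ENNReal.ofReal (X ω) ^ n := by
    intro ω
    rw [Real.exp_eq_exp_ℝ, NormedSpace.exp_eq_tsum_div, ENNReal.ofReal_tsum_of_nonneg]
    · refine tsum_congr fun n => ?_
      rw [← ENNReal.ofReal_pow (hX0 ω), ← ENNReal.ofReal_mul (by positivity)]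
      congr 1
      rw [div_eq_mul_inv (X ω), mul_pow]; ring
    · intro n
      have := hX0 ω
      positivity
    · exact Real.summable_pow_div_factorial _
  have hint : ∫⁻ ω, ENNReal.ofReal (Real.exp (X ω / (2 * M))) ∂P ≤ 2 := by
    simp_rw [hexp]
    rw [lintegral_tsum fun n => by fun_prop]
    calc _ ≤ ∑' n : ℕ, (2⁻¹ : ℝ≥0∞) ^ n := by
          refine ENNReal.tsum_le_tsum fun n => ?_
          rw [lintegral_const_mul _ (by fun_prop)]
          refine (mul_le_mul_right (hmom n) _).trans (le_of_eq ?_)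
          rw [← ENNReal.ofReal_natCast, ← ENNReal.ofReal_pow hM.le,
            ← ENNReal.ofReal_mul (by positivity), ← ENNReal.ofReal_mul (by positivity),
            ← ENNReal.ofReal_ofNat 2, ← ENNReal.ofReal_inv_of_pos (by norm_num),
            ← ENNReal.ofReal_pow (by norm_num)]
          congr 1
          have := Nat.cast_pos (α := ℝ).2 n.factorial_pos
          rw [mul_inv, mul_pow, inv_pow M]
          field_simp
      _ = 2 := by
          rw [ENNReal.tsum_geometric, ENNReal.one_sub_inv_two, inv_inv]
  have hpos := Real.exp_pos (a / (2 * M))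
  have hsub : {ω | a ≤ X ω} ⊆ {ω | ENNReal.ofReal (Real.exp (a / (2 * M)))
      ≤ ENNReal.ofReal (Real.exp (X ω / (2 * M)))} := by
    intro ω hω
    simp only [mem_ofPred_eq] at hω ⊢
    gcongr
  refine (measure_mono hsub).trans ((meas_ge_le_lintegral_div (by fun_prop)
    (by simpa using hpos) ENNReal.ofReal_ne_top).trans ?_)
  rw [Real.exp_neg, ← div_eq_mul_inv, ENNReal.ofReal_div_of_pos hpos, ENNReal.ofReal_ofNat]
  gcongr

/-- Worst-case time integral of the occupation density bound. -/
theorem lintegral_density_bound_le {c γ A α T s : ℝ} (hc : 0 < c) (hγ0 : 0 < γ) (hγ1 : γ < 1)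
    (hA : 0 < A) (hα : 1 ≤ α) (hT : 0 < T) (hs : 0 ≤ s) :
    ∫⁻ r in Ioc s T, ENNReal.ofReal (c / (r - s) ^ γ * (A * r ^ α)) ≤
      ENNReal.ofReal (c * (1 / (1 - γ) + 1) * A * T ^ (α + (1 - γ)) / α ^ (1 - γ)) := by
  have hα0 : 0 < α := by linarith
  set h := T / α with hh
  have hh0 : 0 < h := by positivity
  have h1γ : 0 < 1 - γ := by linarith
  have hint1 : ∫⁻ r in Ioc s (s + h), ENNReal.ofReal (c * A * T ^ α * (r - s) ^ (-γ)) =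
      ENNReal.ofReal (c * A * T ^ α * (h ^ (1 - γ) / (1 - γ))) := by
    have hii : IntervalIntegrable (fun r : ℝ => c * A * T ^ α * (r - s) ^ (-γ)) volume s (s + h) := by
      have := (intervalIntegral.intervalIntegrable_rpow' (a := 0) (b := h)
        (by linarith : -1 < -γ)).comp_sub_right s
      simpa [add_comm] using this.const_mul (c * A * T ^ α)
    rw [← ofReal_integral_eq_lintegral_ofReal
      ((intervalIntegrable_iff_integrableOn_Ioc_of_le (by linarith)).1 hii)
      ((ae_restrict_mem measurableSet_Ioc).mono fun r hr => by
        have : 0 ≤ r - s := by linarith [hr.1]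
        simp only [Pi.zero_apply]
        positivity),
      ← intervalIntegral.integral_of_le (by linarith), intervalIntegral.integral_const_mul,
      intervalIntegral.integral_comp_sub_right (fun r => r ^ (-γ)), sub_self, add_sub_cancel_left,
      integral_rpow (Or.inl (by linarith)), Real.zero_rpow (by linarith), neg_add_eq_sub, sub_zero]
  have hint2 : ∫⁻ r in Ioc 0 T, ENNReal.ofReal (c * A * h ^ (-γ) * r ^ α) =
      ENNReal.ofReal (c * A * h ^ (-γ) * (T ^ (α + 1) / (α + 1))) := by
    have hii : IntervalIntegrable (fun r : ℝ => c * A * h ^ (-γ) * r ^ α) volume 0 T :=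
      (intervalIntegral.intervalIntegrable_rpow' (by linarith)).const_mul _
    rw [← ofReal_integral_eq_lintegral_ofReal
      ((intervalIntegrable_iff_integrableOn_Ioc_of_le hT.le).1 hii)
      ((ae_restrict_mem measurableSet_Ioc).mono fun r hr => by
        have : 0 ≤ r := hr.1.le
        simp only [Pi.zero_apply]
        positivity),
      ← intervalIntegral.integral_of_le hT.le, intervalIntegral.integral_const_mul,
      integral_rpow (Or.inl (by linarith)), Real.zero_rpow (by linarith), sub_zero]
  have hpt : ∀ r ∈ Ioc s T, ENNReal.ofReal (c / (r - s) ^ γ * (A * r ^ α)) ≤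
      (Ioc s (s + h)).indicator
          (fun r => ENNReal.ofReal (c * A * T ^ α * (r - s) ^ (-γ))) r
        + (Ioc 0 T).indicator (fun r => ENNReal.ofReal (c * A * h ^ (-γ) * r ^ α)) r := by
    intro r hr
    have hrs : 0 < r - s := by linarith [hr.1]
    have hr0 : 0 < r := by linarith
    have e : c / (r - s) ^ γ * (A * r ^ α) = c * A * r ^ α * (r - s) ^ (-γ) := by
      rw [Real.rpow_neg hrs.le]; ring
    rw [e]
    by_cases hrh : r ≤ s + h
    · refine le_add_right ?_
      rw [indicator_of_mem (show r ∈ Ioc s (s + h) from ⟨hr.1, hrh⟩)]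
      have := Real.rpow_le_rpow hr0.le hr.2 hα0.le
      gcongr
    · refine le_add_left ?_
      rw [indicator_of_mem (show r ∈ Ioc 0 T from ⟨hr0, hr.2⟩), mul_right_comm]
      have := Real.rpow_le_rpow_of_nonpos hh0 (by linarith : h ≤ r - s) (by linarith : -γ ≤ 0)
      gcongr
  calc _ ≤ ∫⁻ r in Ioc s T, ((Ioc s (s + h)).indicator
          (fun r => ENNReal.ofReal (c * A * T ^ α * (r - s) ^ (-γ))) r
        + (Ioc 0 T).indicator (fun r => ENNReal.ofReal (c * A * h ^ (-γ) * r ^ α)) r) :=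
        setLIntegral_mono' measurableSet_Ioc hpt
    _ ≤ ∫⁻ r, ((Ioc s (s + h)).indicator
          (fun r => ENNReal.ofReal (c * A * T ^ α * (r - s) ^ (-γ))) r
        + (Ioc 0 T).indicator (fun r => ENNReal.ofReal (c * A * h ^ (-γ) * r ^ α)) r) :=
        setLIntegral_le_lintegral _ _
    _ = ENNReal.ofReal (c * A * T ^ α * (h ^ (1 - γ) / (1 - γ))) +
        ENNReal.ofReal (c * A * h ^ (-γ) * (T ^ (α + 1) / (α + 1))) := by
        rw [lintegral_add_left (Measurable.indicator (by fun_prop) measurableSet_Ioc),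
          lintegral_indicator measurableSet_Ioc, lintegral_indicator measurableSet_Ioc, hint1, hint2]
    _ ≤ _ := by
        rw [← ENNReal.ofReal_add (by positivity) (by positivity)]
        apply ENNReal.ofReal_le_ofReal
        have e1 : h ^ (1 - γ) = T ^ (1 - γ) / α ^ (1 - γ) := Real.div_rpow hT.le hα0.le _
        have e2 : h ^ (-γ) = T ^ (1 - γ) / α ^ (1 - γ) * (α / T) := by
          rw [← e1, show -γ = (1 - γ) - 1 by ring, Real.rpow_sub_one hh0.ne', hh]
          field_simp
        rw [e1, e2, Real.rpow_add_one hT.ne', Real.rpow_add hT]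
        have e3 : α / (α + 1) ≤ 1 := by rw [div_le_one (by linarith)]; linarith
        have : c * A * (T ^ (1 - γ) / α ^ (1 - γ) * (α / T)) * (T ^ α * T / (α + 1))
          = c * A * (T ^ (1 - γ) / α ^ (1 - γ)) * T ^ α * (α / (α + 1)) := by
          field_simp
        rw [this]
        have := mul_le_mul_of_nonneg_left e3
          (by positivity : 0 ≤ c * A * (T ^ (1 - γ) / α ^ (1 - γ)) * T ^ α)
        refine (add_le_add_right this _).trans (le_of_eq ?_)
        ring

/-- Exponential tail of the occupation time `C_T` at a fixed time `T`. -/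
theorem occupation_time_tail_le (P : Measure Ω) [IsProbabilityMeasure P]
    (ℱ : Filtration ℝ mΩ) (B : ℝ → Ω → ℝ)
    (hBadapted : Adapted ℱ B) (hBcont : ∀ ω, Continuous fun t => B t ω)
    {c γ : ℝ} (hc : 0 < c) (hγ : γ ∈ Ioo (0:ℝ) 1)
    (hdens : ∀ s t : ℝ, 0 ≤ s → s < t →
      ∀ A : Set ℝ, MeasurableSet A → volume A < ⊤ →
      ∀ᵐ ω ∂P, (P[(fun ω => A.indicator (fun _ => (1:ℝ)) (B t ω)) | ℱ s]) ω ≤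
        c / (t - s) ^ γ * (volume A).toReal)
    {α A T : ℝ} (hα : 1 ≤ α) (hA : 0 < A) (hT : 0 < T) (a : ℝ) :
    P {ω | a ≤ (volume {s ∈ Ioc (0:ℝ) T | 0 < B s ω ∧ B s ω < A * s ^ α}).toReal} ≤
      ENNReal.ofReal (2 * Real.exp (-(a / (2 *
        (c * (1 / (1 - γ) + 1) * A * T ^ (α + (1 - γ)) / α ^ (1 - γ)))))) := by
  have h1γ : 0 < 1 - γ := by linarith [hγ.2]
  set D : Set (ℝ × Ω) := {p | p.1 ∈ Ioc 0 T ∧ 0 < B p.1 p.2 ∧ B p.1 p.2 < A * p.1 ^ α} with hDdef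
  have hB : Measurable fun p : ℝ × Ω => B p.1 p.2 :=
    measurable_uncurry_of_continuous_of_measurable hBcont fun i => (hBadapted i).mono (ℱ.le i) le_rfl
  have hD : MeasurableSet D :=
    (measurableSet_preimage measurable_fst measurableSet_Ioc).inter
      ((measurableSet_lt measurable_const hB).inter (measurableSet_lt hB (by fun_prop)))
  have hDF : ∀ r, MeasurableSet[ℱ r] {ω | (r, ω) ∈ D} := by
    intro r
    have : {ω | (r, ω) ∈ D} = {_ω | r ∈ Ioc 0 T} ∩ B r ⁻¹' Ioo 0 (A * r ^ α) := by
      ext ω; rfl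
    rw [this]
    exact MeasurableSet.inter (MeasurableSet.const _) (hBadapted r measurableSet_Ioo)
  have hsec : ∀ ω, {r | (r, ω) ∈ D} ∩ Ioi 0
      = {s ∈ Ioc (0:ℝ) T | 0 < B s ω ∧ B s ω < A * s ^ α} := fun ω =>
    inter_eq_left.2 fun r hr => hr.1.1
  have hfin : ∀ ω, volume ({r | (r, ω) ∈ D} ∩ Ioi 0) ≠ ∞ := fun ω =>
    ((measure_mono (fun r hr => hr.1.1 : {r | (r, ω) ∈ D} ∩ Ioi 0 ⊆ Ioc 0 T)).trans_lt
      measure_Ioc_lt_top).ne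
  have hk : ∀ s r, 0 ≤ s → s < r → r ≤ T → ∀ G, MeasurableSet[ℱ s] G →
      P (G ∩ {ω | (r, ω) ∈ D}) ≤ ENNReal.ofReal (c / (r - s) ^ γ * (A * r ^ α)) * P G := by
    intro s r hs hsr _ G hG
    have hr0 : 0 < r := by linarith
    have hBr := (hBadapted r).mono (ℱ.le r) le_rfl
    have hd := hdens s r hs hsr (Ioo 0 (A * r ^ α)) measurableSet_Ioo measure_Ioo_lt_top
    have hpos : 0 ≤ A * r ^ α := by positivity
    rw [Real.volume_Ioo, sub_zero, ENNReal.toReal_ofReal hpos] at hd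
    have hmeas : MeasurableSet (B r ⁻¹' Ioo 0 (A * r ^ α)) := hBr measurableSet_Ioo
    have hi : Integrable (fun ω => (Ioo 0 (A * r ^ α)).indicator (fun _ => (1:ℝ)) (B r ω)) P :=
      (integrable_const (1:ℝ)).indicator hmeas
    have h1 := setIntegral_mono_ae (s := G) integrable_condExp.integrableOn
      (integrable_const (μ := P) (c / (r - s) ^ γ * (A * r ^ α))).integrableOn hd
    rw [setIntegral_condExp (ℱ.le s) hi hG, setIntegral_const, smul_eq_mul] at h1
    have h2 : ∫ ω in G, (Ioo 0 (A * r ^ α)).indicator (fun _ => (1:ℝ)) (B r ω) ∂P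
        = P.real (G ∩ B r ⁻¹' Ioo 0 (A * r ^ α)) := by
      have := integral_indicator_one (μ := P.restrict G) hmeas
      rw [measureReal_restrict_apply hmeas, inter_comm] at this
      exact this
    rw [h2] at h1
    have h3 : 0 ≤ c / (r - s) ^ γ * (A * r ^ α) := by
      have : 0 < r - s := by linarith
      positivity
    calc P (G ∩ {ω | (r, ω) ∈ D}) ≤ P (G ∩ B r ⁻¹' Ioo 0 (A * r ^ α)) :=
          measure_mono (inter_subset_inter_right _ fun ω hω => hω.2)
      _ = ENNReal.ofReal (P.real (G ∩ B r ⁻¹' Ioo 0 (A * r ^ α))) := (ofReal_measureReal).symm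
      _ ≤ ENNReal.ofReal (P.real G * (c / (r - s) ^ γ * (A * r ^ α))) :=
          ENNReal.ofReal_le_ofReal h1
      _ = _ := by rw [mul_comm, ENNReal.ofReal_mul h3, ofReal_measureReal]
  have hX : Measurable fun ω => (volume ({r | (r, ω) ∈ D} ∩ Ioi 0)).toReal :=
    ((measurable_volume_section_Ioi hD).comp measurable_prodMk_left).ennreal_toReal
  have hM : 0 < c * (1 / (1 - γ) + 1) * A * T ^ (α + (1 - γ)) / α ^ (1 - γ) := by
    have : 0 < α := by linarith
    positivity
  have := measure_le_of_moments_le P hX (fun _ => ENNReal.toReal_nonneg) hM (fun n => by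
    have h := setLIntegral_volume_section_pow_le P ℱ hD (fun r ω h => h.1.2) hDF _ _ hk
      (fun s hs => lintegral_density_bound_le hc hγ.1 hγ.2 hA hα hT hs) ENNReal.ofReal_ne_top
      n 0 le_rfl univ MeasurableSet.univ
    simpa [ENNReal.ofReal_toReal (hfin _)] using h) a
  simpa only [hsec] using this

end

theorem exists_mul_exp_le (p b : ℝ) (hb : 0 < b) (hp : 0 < p) :
    ∃ K : ℝ, 0 < K ∧ ∀ x : ℝ, 1 ≤ x → x * Real.exp (-(b * x ^ p)) ≤ K := by
  obtain ⟨N, hN⟩ := exists_nat_ge (1 / p)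
  refine ⟨N.factorial / b ^ N, by positivity, fun x hx => ?_⟩
  have hx0 : 0 < x := by linarith
  have h1 : x ≤ (x ^ p) ^ N := by
    rw [← Real.rpow_natCast, ← Real.rpow_mul hx0.le]
    refine Real.self_le_rpow_of_one_le hx ?_
    rwa [div_le_iff₀' hp] at hN
  have h2 := Real.pow_div_factorial_le_exp (b * x ^ p) (by positivity) N
  rw [Real.exp_neg, ← div_eq_mul_inv, div_le_iff₀ (Real.exp_pos _)]
  calc x ≤ (x ^ p) ^ N := h1
    _ = N.factorial / b ^ N * ((b * x ^ p) ^ N / N.factorial) := by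
      have := Nat.cast_pos (α := ℝ).2 N.factorial_pos
      rw [mul_pow]; field_simp
    _ ≤ _ := by gcongr

theorem inv_one_sub_exp_neg_le {x : ℝ} (hx : 0 < x) : (1 - Real.exp (-x))⁻¹ ≤ 1 + 1 / x := by
  have h1 : Real.exp (-x) ≤ (1 + x)⁻¹ := by
    rw [Real.exp_neg]
    gcongr
    linarith [Real.add_one_le_exp x]
  have h2 : (1 + 1 / x)⁻¹ = 1 - (1 + x)⁻¹ := by
    field_simp
    ring
  rw [inv_le_comm₀ (by linarith [Real.exp_lt_exp.2 (by linarith : -x < 0), Real.exp_zero]) (by positivity), h2]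
  linarith

/-- Each time in `(0, 1/2]` lies just below a point of the geometric grid of ratio `exp (-1/α)`. -/
theorem exists_grid_point {α t : ℝ} (hα : 0 < α) (ht0 : 0 < t) (ht : t ≤ 1 / 2) :
    ∃ k : ℕ, t ≤ 1 / 2 * Real.exp (-(k / α)) ∧
      1 / 2 * Real.exp (-(k / α)) * Real.exp (-(1 / α)) ≤ t := by
  have e : ∀ x : ℝ, 1 / 2 * Real.exp (-x) = Real.exp (-(x + Real.log 2)) := by
    intro x
    rw [neg_add, Real.exp_add, Real.exp_neg (Real.log 2), Real.exp_log (by norm_num)]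
    ring
  have hlog : Real.log t ≤ -Real.log 2 := by
    rw [← Real.log_inv]
    exact Real.log_le_log ht0 (by linarith)
  have hnn : 0 ≤ α * (-Real.log t - Real.log 2) := mul_nonneg hα.le (by linarith)
  refine ⟨⌊α * (-Real.log t - Real.log 2)⌋₊, ?_, ?_⟩
  · rw [e, ← Real.log_le_iff_le_exp ht0]
    have := Nat.floor_le hnn
    rw [← div_le_iff₀' hα] at this
    linarith
  · rw [mul_assoc, ← Real.exp_add, ← neg_add, e, ← Real.le_log_iff_exp_le ht0, ← add_div]
    have := (Nat.lt_floor_add_one (α * (-Real.log t - Real.log 2))).le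
    rw [← le_div_iff₀' hα] at this
    linarith

/-- Lemma 2.15: if the continuous adapted process `B` has conditional densities bounded
by `c (t-s)^{-γ}`, `δ = (1-γ)/4`, and `C_t = ∫_0^t 1_{(0 < B_s < A s^α)} ds`, then for
each `ξ > 0` there are constants `c1, c2 > 0` such that for `α ≥ 1`, `A, Bc > 0` with
`Bc/A > ξ` and `β = α + δ`,
`P(C_t ≥ Bc t^β` for some `t ≤ 1/2) ≤ c1 exp(-c2 Bc α^δ / A)`. -/
theorem occupation_time_uniform_exponential_bound
    {Ω : Type*} [mΩ : MeasurableSpace Ω] (P : Measure Ω) [IsProbabilityMeasure P]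
    (ℱ : Filtration ℝ mΩ) (B : ℝ → Ω → ℝ)
    (hBadapted : Adapted ℱ B) (hBcont : ∀ ω, Continuous fun t => B t ω)
    (c γ : ℝ) (hc : 0 < c) (hγ : γ ∈ Ioo (0:ℝ) 1)
    (hdens : ∀ s t : ℝ, 0 ≤ s → s < t →
      ∀ A : Set ℝ, MeasurableSet A → volume A < ⊤ →
      ∀ᵐ ω ∂P, (P[(fun ω => A.indicator (fun _ => (1:ℝ)) (B t ω)) | ℱ s]) ω ≤
        c / (t - s) ^ γ * (volume A).toReal)
    (δ : ℝ) (hδ : δ = (1 - γ) / 4)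
    (ξ : ℝ) (hξ : 0 < ξ) :
    ∃ c1 c2 : ℝ, 0 < c1 ∧ 0 < c2 ∧
      ∀ α : ℝ, 1 ≤ α → ∀ A Bc : ℝ, 0 < A → 0 < Bc → ξ < Bc / A →
        ∀ β : ℝ, β = α + δ →
        P {ω | ∃ t : ℝ, 0 < t ∧ t ≤ 1 / 2 ∧
            Bc * t ^ β ≤
              (volume {s ∈ Ioc (0:ℝ) t | 0 < B s ω ∧ B s ω < A * s ^ α}).toReal} ≤
          ENNReal.ofReal (c1 * Real.exp (-(c2 * Bc * α ^ δ / A))) := by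
  obtain ⟨hγ0, hγ1⟩ := hγ
  have hδ0 : 0 < δ := by linarith
  have h4δ : 1 - γ = 4 * δ := by linarith
  set K := c * (1 / (1 - γ) + 1) with hK
  have hK0 : 0 < K := by
    have : 0 < 1 - γ := by linarith
    positivity
  set κ := Real.exp (-2) / (2 * K) with hκ
  have hκ0 : 0 < κ := by positivity
  obtain ⟨K', hK'0, hK'⟩ := exists_mul_exp_le (4 * δ) (κ * ξ / 2) (by positivity) (by positivity)
  refine ⟨2 * (1 + 1 / (3 * δ * (κ * ξ))) * K', κ / 2, by positivity, by positivity, ?_⟩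
  rintro α hα A Bc hA hBc hξA β rfl
  have hα0 : 0 < α := by linarith
  set X := κ * (Bc / A) with hX
  have hXξ : κ * ξ ≤ X := mul_le_mul_of_nonneg_left hξA.le hκ0.le
  have hX0 : 0 < X := by positivity
  set Y := X * α ^ (4 * δ) with hY
  have hY0 : 0 < Y := by positivity
  have hone : 1 ≤ α ^ (4 * δ) := Real.one_le_rpow hα (by positivity)
  set T : ℕ → ℝ := fun k => 1 / 2 * Real.exp (-(k / α)) with hT
  have hT0 : ∀ k, 0 < T k := fun k => by positivity
  set q := Real.exp (-(3 * δ * Y / α)) with hq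
  have hq1 : q < 1 := by
    have : 0 < 3 * δ * Y / α := by positivity
    rw [hq, ← Real.exp_zero]
    gcongr
    linarith
  have hgrid : ∀ k : ℕ, P {ω | Real.exp (-2) * Bc * T k ^ (α + δ) ≤
      (volume {s ∈ Ioc (0:ℝ) (T k) | 0 < B s ω ∧ B s ω < A * s ^ α}).toReal} ≤
      ENNReal.ofReal (2 * Real.exp (-Y) * q ^ k) := by
    intro k
    refine (occupation_time_tail_le P ℱ B hBadapted hBcont hc ⟨hγ0, hγ1⟩ hdens hα hA
      (hT0 k) _).trans (ENNReal.ofReal_le_ofReal ?_)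
    rw [mul_assoc 2, hq, ← Real.exp_nat_mul, ← Real.exp_add, ← hK, h4δ]
    gcongr
    have e1 : Real.exp (-2) * Bc * T k ^ (α + δ) /
        (2 * (K * A * T k ^ (α + 4 * δ) / α ^ (4 * δ))) = Y * T k ^ (-(3 * δ)) := by
      rw [show -(3 * δ) = (α + δ) - (α + 4 * δ) by ring, Real.rpow_sub (hT0 k), hY, hX, hκ]
      field_simp
    have e2 : 1 + 3 * δ * (k / α) ≤ T k ^ (-(3 * δ)) := by
      rw [Real.rpow_def_of_pos (hT0 k), hT]
      simp only
      rw [Real.log_mul (by norm_num) (Real.exp_pos _).ne', Real.log_exp]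
      refine le_trans ?_ (Real.add_one_le_exp _)
      have : Real.log (1 / 2) ≤ 0 := Real.log_nonpos (by norm_num) (by norm_num)
      nlinarith
    rw [e1]
    calc _ ≤ -(Y * (1 + 3 * δ * (k / α))) := by gcongr
      _ = _ := by ring
  have hcover : {ω | ∃ t : ℝ, 0 < t ∧ t ≤ 1 / 2 ∧ Bc * t ^ (α + δ) ≤
      (volume {s ∈ Ioc (0:ℝ) t | 0 < B s ω ∧ B s ω < A * s ^ α}).toReal} ⊆
      ⋃ k : ℕ, {ω | Real.exp (-2) * Bc * T k ^ (α + δ) ≤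
      (volume {s ∈ Ioc (0:ℝ) (T k) | 0 < B s ω ∧ B s ω < A * s ^ α}).toReal} := by
    rintro ω ⟨t, ht0, ht, h⟩
    obtain ⟨k, hk1, hk2⟩ := exists_grid_point hα0 ht0 ht
    refine mem_iUnion.2 ⟨k, ?_⟩
    have h1 : (volume {s ∈ Ioc (0:ℝ) t | 0 < B s ω ∧ B s ω < A * s ^ α}).toReal ≤
        (volume {s ∈ Ioc (0:ℝ) (T k) | 0 < B s ω ∧ B s ω < A * s ^ α}).toReal :=
      ENNReal.toReal_mono ((measure_mono (sep_subset _ _)).trans_lt measure_Ioc_lt_top).ne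
        (measure_mono fun s hs => ⟨⟨hs.1.1, hs.1.2.trans hk1⟩, hs.2⟩)
    refine le_trans ?_ (h.trans h1)
    have h2 := Real.rpow_le_rpow (by positivity) hk2 (by positivity : 0 ≤ α + δ)
    rw [Real.mul_rpow (hT0 k).le (Real.exp_pos _).le, ← Real.exp_mul] at h2
    have h3 : Real.exp (-2) ≤ Real.exp (-(1 / α) * (α + δ)) := by
      gcongr
      rw [neg_mul, neg_le_neg_iff, one_div_mul_eq_div, div_le_iff₀ hα0]
      linarith
    calc Real.exp (-2) * Bc * T k ^ (α + δ) = Bc * (T k ^ (α + δ) * Real.exp (-2)) := by ring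
      _ ≤ Bc * (T k ^ (α + δ) * Real.exp (-(1 / α) * (α + δ))) := by gcongr
      _ ≤ _ := by gcongr
  have hsum : HasSum (fun k : ℕ => 2 * Real.exp (-Y) * q ^ k) (2 * Real.exp (-Y) * (1 - q)⁻¹) :=
    (hasSum_geometric_of_lt_one (Real.exp_pos _).le hq1).mul_left _
  calc _ ≤ ∑' k : ℕ, P {ω | Real.exp (-2) * Bc * T k ^ (α + δ) ≤
      (volume {s ∈ Ioc (0:ℝ) (T k) | 0 < B s ω ∧ B s ω < A * s ^ α}).toReal} :=
        (measure_mono hcover).trans (measure_iUnion_le _)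
    _ ≤ ∑' k : ℕ, ENNReal.ofReal (2 * Real.exp (-Y) * q ^ k) := ENNReal.tsum_le_tsum hgrid
    _ = ENNReal.ofReal (2 * Real.exp (-Y) * (1 - q)⁻¹) := by
        rw [← ENNReal.ofReal_tsum_of_nonneg (fun k => by positivity) hsum.summable, hsum.tsum_eq]
    _ ≤ _ := by
        apply ENNReal.ofReal_le_ofReal
        have hYξ : κ * ξ ≤ Y := hXξ.trans (le_mul_of_one_le_right hX0.le hone)
        have h1 : (1 - q)⁻¹ ≤ (1 + 1 / (3 * δ * (κ * ξ))) * α :=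
          calc (1 - q)⁻¹ ≤ 1 + 1 / (3 * δ * Y / α) := inv_one_sub_exp_neg_le (by positivity)
            _ ≤ α + 1 / (3 * δ * (κ * ξ) / α) := by gcongr
            _ = _ := by field_simp
        have h2 : Real.exp (-Y) ≤
            Real.exp (-(κ * ξ / 2 * α ^ (4 * δ))) * Real.exp (-(κ / 2 * Bc * α ^ δ / A)) := by
          rw [← Real.exp_add]
          gcongr
          have h3 : α ^ δ ≤ α ^ (4 * δ) := Real.rpow_le_rpow_of_exponent_le hα (by linarith)
          have h4 : κ / 2 * Bc * α ^ δ / A ≤ X / 2 * α ^ (4 * δ) :=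
            calc κ / 2 * Bc * α ^ δ / A = X / 2 * α ^ δ := by rw [hX]; ring
              _ ≤ _ := by gcongr
          have h5 : κ * ξ / 2 * α ^ (4 * δ) ≤ X / 2 * α ^ (4 * δ) := by gcongr
          linarith
        calc 2 * Real.exp (-Y) * (1 - q)⁻¹
            ≤ 2 * (Real.exp (-(κ * ξ / 2 * α ^ (4 * δ))) *
              Real.exp (-(κ / 2 * Bc * α ^ δ / A))) * ((1 + 1 / (3 * δ * (κ * ξ))) * α) := by
              gcongr
          _ = 2 * (1 + 1 / (3 * δ * (κ * ξ))) *
              (α * Real.exp (-(κ * ξ / 2 * α ^ (4 * δ)))) *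
              Real.exp (-(κ / 2 * Bc * α ^ δ / A)) := by ring
          _ ≤ _ := by
              gcongr
              exact hK' α hα
end
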